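/- arXiv:1504.01907 — 5 statements merged into one kernel-verified Lean document; each statement's English description precedes it below -/
import Mathlib

section
/- Fix T > 0, an integer N ≥ 1, r > 0 and ρ ∈ (0, min{r, T}]. Let w : [0,T] × B(0,r) → ℝ be measurable and essentially bounded, where B(0,r) is the open Euclidean ball of radius r in ℝ^N. For h ∈ (0, ρ) define A_h = {(t,X,s,Y) ∈ ([0,T] × ℝ^N)² : |t−s| ≤ h, (t+s)/2 ∈ [ρ, T−ρ], ‖X−Y‖ ≤ h, ‖X+Y‖/2 ≤ r−ρ}. Then lim_{h→0+} h^{−(1+N)} ∫_{A_h} |w(t,X) − w(s,Y)| dt dX ds dY = 0. (Lemma 5.1, Kružkov's Lemma 2.) -/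
open MeasureTheory Metric Set Filter

theorem kr_one {G : Type*} [NormedAddCommGroup G] [NormedSpace ℝ G] [FiniteDimensional ℝ G]
    [MeasurableSpace G] [BorelSpace G] (μ : Measure G) [μ.IsAddHaarMeasure]
    (φ : G → ENNReal) (hφ : Measurable φ) (h : ℝ) (hh : 0 ≤ h) :
    ∫⁻ q in {q : G × G | dist q.1 q.2 ≤ h}, φ q.1 ∂(μ.prod μ)
      = μ (closedBall 0 h) * ∫⁻ p, φ p ∂μ := by
  have hS : MeasurableSet {q : G × G | dist q.1 q.2 ≤ h} :=
    (isClosed_le (by fun_prop) (by fun_prop)).measurableSet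
  rw [← lintegral_indicator hS, lintegral_prod _ (by
    exact (Measurable.indicator (by fun_prop) hS).aemeasurable)]
  rw [← lintegral_const_mul _ hφ]
  congr 1
  ext p
  have : ∀ y, ({q : G × G | dist q.1 q.2 ≤ h}.indicator (fun q => φ q.1) (p, y))
      = (closedBall p h).indicator (fun _ => φ p) y := by
    intro y
    simp [Set.indicator, dist_comm]
  simp_rw [this]
  rw [lintegral_indicator measurableSet_closedBall, setLIntegral_const,
    Measure.addHaar_closedBall_center, mul_comm]

theorem kr_two {G : Type*} [NormedAddCommGroup G] [NormedSpace ℝ G] [FiniteDimensional ℝ G]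
    [MeasurableSpace G] [BorelSpace G] (μ : Measure G) [μ.IsAddHaarMeasure]
    (φ : G → ENNReal) (hφ : Measurable φ) (h : ℝ) (hh : 0 ≤ h) :
    ∫⁻ q in {q : G × G | dist q.1 q.2 ≤ h}, φ q.2 ∂(μ.prod μ)
      = μ (closedBall 0 h) * ∫⁻ p, φ p ∂μ := by
  have hS : MeasurableSet {q : G × G | dist q.1 q.2 ≤ h} :=
    (isClosed_le (by fun_prop) (by fun_prop)).measurableSet
  rw [← kr_one μ φ hφ h hh, ← lintegral_indicator hS, ← lintegral_indicator hS,
    ← lintegral_prod_swap]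
  congr 1
  ext q
  simp [Set.indicator, dist_comm]

theorem kr_main {G : Type*} [NormedAddCommGroup G] [NormedSpace ℝ G] [FiniteDimensional ℝ G]
    [MeasurableSpace G] [BorelSpace G] (μ : Measure G) [μ.IsAddHaarMeasure]
    (f : G → ℝ) (hfm : Measurable f) (hf : Integrable f μ) (Ω : Set G) (hΩ : MeasurableSet Ω)
    (ε : NNReal) (hε : 0 < ε) :
    ∃ δ > 0, ∀ h, 0 < h → h < δ → ∀ A ⊆ {q : G × G | q.1 ∈ Ω ∧ dist q.1 q.2 ≤ h},
      ∫⁻ q in A, ‖f q.1 - f q.2‖ₑ ∂(μ.prod μ)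
        ≤ μ (closedBall 0 h) * (ε * (2 + μ Ω)) := by
  obtain ⟨g, hgc, hfg, hg, -⟩ := hf.exists_hasCompactSupport_lintegral_sub_le
    (ε := (ε : ENNReal)) (by simpa using hε.ne')
  have hgu := hgc.uniformContinuous_of_continuous hg
  obtain ⟨δ, hδ, hgδ⟩ := Metric.uniformContinuous_iff.1 hgu ε (by exact_mod_cast hε)
  refine ⟨δ, hδ, fun h h0 hhδ A hA => ?_⟩
  set S := {q : G × G | dist q.1 q.2 ≤ h}
  have hS : MeasurableSet S :=
    (isClosed_le (by fun_prop) (by fun_prop)).measurableSet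
  set φ : G → ENNReal := fun p => ‖f p - g p‖ₑ
  have hgm := hg.measurable
  have hφ : Measurable φ := by fun_prop
  set χ : G → ENNReal := Ω.indicator (fun _ => (ε : ENNReal))
  have hχ : Measurable χ := measurable_const.indicator hΩ
  have hAm : MeasurableSet {q : G × G | q.1 ∈ Ω ∧ dist q.1 q.2 ≤ h} :=
    (measurable_fst hΩ).inter hS
  calc ∫⁻ q in A, ‖f q.1 - f q.2‖ₑ ∂(μ.prod μ)
      ≤ ∫⁻ q in {q : G × G | q.1 ∈ Ω ∧ dist q.1 q.2 ≤ h}, ‖f q.1 - f q.2‖ₑ ∂(μ.prod μ) :=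
        lintegral_mono_set hA
    _ ≤ ∫⁻ q in {q : G × G | q.1 ∈ Ω ∧ dist q.1 q.2 ≤ h},
          (φ q.1 + φ q.2 + χ q.1) ∂(μ.prod μ) := by
        apply setLIntegral_mono' hAm
        rintro ⟨p, q⟩ ⟨hp, hd⟩
        simp only at hp hd
        have h1 : ‖g p - g q‖ₑ ≤ ε := by
          have := (hgδ (lt_of_le_of_lt hd hhδ)).le
          rw [Real.dist_eq, ← Real.norm_eq_abs] at this
          rw [enorm_le_coe]
          exact_mod_cast this
        have h2 : f p - f q = (f p - g p) + (-(f q - g q)) + (g p - g q) := by ring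
        simp only [φ, χ, Set.indicator_of_mem hp]
        rw [h2]
        refine (enorm_add_le _ _).trans (add_le_add ((enorm_add_le _ _).trans ?_) h1)
        rw [enorm_neg]
    _ ≤ ∫⁻ q in S, (φ q.1 + φ q.2 + χ q.1) ∂(μ.prod μ) :=
        lintegral_mono_set (fun q hq => hq.2)
    _ = μ (closedBall 0 h) * (∫⁻ p, φ p ∂μ) + μ (closedBall 0 h) * (∫⁻ p, φ p ∂μ)
          + μ (closedBall 0 h) * (∫⁻ p, χ p ∂μ) := by
        rw [lintegral_add_right _ (by fun_prop), lintegral_add_right _ (by fun_prop),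
          kr_one μ φ hφ h h0.le, kr_one μ χ hχ h h0.le, kr_two μ φ hφ h h0.le]
    _ ≤ μ (closedBall 0 h) * ε + μ (closedBall 0 h) * ε
          + μ (closedBall 0 h) * (ε * μ Ω) := by
        have : ∫⁻ p, χ p ∂μ = ε * μ Ω := by
          rw [lintegral_indicator hΩ, setLIntegral_const]
        rw [this]
        gcongr
    _ = _ := by ring

/-- Kružkov's Lemma 2 (Lemma 5.1): for a measurable, essentially bounded
`w` on `[0,T] × B(0,r)`, the averaged modulus of continuity over the doubled
region `A_h` vanishes as `h → 0+`. -/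
theorem kruzkov_lemma2
    (T : ℝ) (hT : 0 < T) (N : ℕ) (hN : 1 ≤ N) (r : ℝ) (hr : 0 < r)
    (ρ : ℝ) (hρ : ρ ∈ Set.Ioc 0 (min r T))
    (w : ℝ × EuclideanSpace ℝ (Fin N) → ℝ)
    (hw_meas : Measurable w)
    (hw_bd : ∃ M : ℝ, ∀ᵐ p ∂(volume.restrict
        ((Set.Icc (0:ℝ) T) ×ˢ (ball (0 : EuclideanSpace ℝ (Fin N)) r))), |w p| ≤ M) :
    Tendsto
      (fun h : ℝ =>
        (1 / h ^ (1 + N)) *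
          ∫ q in {q : (ℝ × EuclideanSpace ℝ (Fin N)) × (ℝ × EuclideanSpace ℝ (Fin N)) |
              q.1.1 ∈ Set.Icc (0:ℝ) T ∧ q.2.1 ∈ Set.Icc (0:ℝ) T ∧
              |q.1.1 - q.2.1| ≤ h ∧ (q.1.1 + q.2.1) / 2 ∈ Set.Icc ρ (T - ρ) ∧
              ‖q.1.2 - q.2.2‖ ≤ h ∧ ‖q.1.2 + q.2.2‖ / 2 ≤ r - ρ},
            |w q.1 - w q.2|)
      (nhdsWithin 0 (Set.Ioo 0 ρ)) (nhds 0) := by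
  obtain ⟨M, hM⟩ := hw_bd
  set Ω := (Set.Icc (0:ℝ) T) ×ˢ (ball (0 : EuclideanSpace ℝ (Fin N)) r) with hΩdef
  have hΩ : MeasurableSet Ω := measurableSet_Icc.prod measurableSet_ball
  have hΩfin : volume Ω ≠ ⊤ := by
    rw [hΩdef, Measure.volume_eq_prod, Measure.prod_prod]
    exact ENNReal.mul_ne_top (by simp) measure_ball_lt_top.ne
  set f := Ω.indicator w with hfdef
  have hfm : Measurable f := hw_meas.indicator hΩ
  have hf : Integrable f volume := by
    rw [hfdef, integrable_indicator_iff hΩ]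
    exact Measure.integrableOn_of_bounded hΩfin hw_meas.aestronglyMeasurable hM
  haveI : (volume : Measure (ℝ × EuclideanSpace ℝ (Fin N))).IsAddHaarMeasure := by
    rw [Measure.volume_eq_prod]; infer_instance
  set C := (volume (closedBall (0 : ℝ × EuclideanSpace ℝ (Fin N)) 1)).toNNReal with hC
  set K := (volume Ω).toNNReal with hK
  rw [Metric.tendsto_nhds]
  intro η hη
  have hpos : 0 < (C : ℝ) * (2 + K) + 1 := by positivity
  set ε : NNReal := ⟨η / (C * (2 + K) + 1), by positivity⟩ with hεdef
  have hε : 0 < ε := by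
    rw [← NNReal.coe_pos]; exact div_pos hη hpos
  obtain ⟨δ, hδ, hmain⟩ := kr_main volume f hfm hf Ω hΩ ε hε
  have hnear : ∀ᶠ h in nhdsWithin 0 (Set.Ioo 0 ρ), h < δ :=
    nhdsWithin_le_nhds (Iio_mem_nhds hδ)
  filter_upwards [hnear, self_mem_nhdsWithin] with h hhδ hh
  obtain ⟨h0, hhρ⟩ := hh
  set A := {q : (ℝ × EuclideanSpace ℝ (Fin N)) × (ℝ × EuclideanSpace ℝ (Fin N)) |
              q.1.1 ∈ Set.Icc (0:ℝ) T ∧ q.2.1 ∈ Set.Icc (0:ℝ) T ∧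
              |q.1.1 - q.2.1| ≤ h ∧ (q.1.1 + q.2.1) / 2 ∈ Set.Icc ρ (T - ρ) ∧
              ‖q.1.2 - q.2.2‖ ≤ h ∧ ‖q.1.2 + q.2.2‖ / 2 ≤ r - ρ} with hA
  have hAm : MeasurableSet A := by
    apply IsClosed.measurableSet
    have e1 : IsClosed {q : (ℝ × EuclideanSpace ℝ (Fin N)) × (ℝ × EuclideanSpace ℝ (Fin N)) | q.1.1 ∈ Set.Icc (0:ℝ) T} :=
      isClosed_Icc.preimage (by fun_prop)
    have e2 : IsClosed {q : (ℝ × EuclideanSpace ℝ (Fin N)) × (ℝ × EuclideanSpace ℝ (Fin N)) | q.2.1 ∈ Set.Icc (0:ℝ) T} :=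
      isClosed_Icc.preimage (by fun_prop)
    have e4 : IsClosed {q : (ℝ × EuclideanSpace ℝ (Fin N)) × (ℝ × EuclideanSpace ℝ (Fin N)) | (q.1.1 + q.2.1) / 2 ∈ Set.Icc ρ (T - ρ)} :=
      isClosed_Icc.preimage (by fun_prop)
    have e3 : IsClosed {q : (ℝ × EuclideanSpace ℝ (Fin N)) × (ℝ × EuclideanSpace ℝ (Fin N)) | |q.1.1 - q.2.1| ≤ h} :=
      isClosed_le (by fun_prop) (by fun_prop)
    have e5 : IsClosed {q : (ℝ × EuclideanSpace ℝ (Fin N)) × (ℝ × EuclideanSpace ℝ (Fin N)) | ‖q.1.2 - q.2.2‖ ≤ h} :=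
      isClosed_le (by fun_prop) (by fun_prop)
    have e6 : IsClosed {q : (ℝ × EuclideanSpace ℝ (Fin N)) × (ℝ × EuclideanSpace ℝ (Fin N)) | ‖q.1.2 + q.2.2‖ / 2 ≤ r - ρ} :=
      isClosed_le (by fun_prop) (by fun_prop)
    exact e1.inter (e2.inter (e3.inter (e4.inter (e5.inter e6))))
  have hAΩ : ∀ q ∈ A, q.1 ∈ Ω ∧ q.2 ∈ Ω ∧ dist q.1 q.2 ≤ h := by
    rintro ⟨⟨t, X⟩, ⟨s, Y⟩⟩ ⟨h1, h2, h3, h4, h5, h6⟩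
    simp only at h1 h2 h3 h4 h5 h6
    have hX : (2:ℝ) * ‖X‖ ≤ ‖X + Y‖ + ‖X - Y‖ := by
      have := norm_add_le (X + Y) (X - Y)
      have e : (X + Y) + (X - Y) = (2:ℝ) • X := by rw [two_smul]; abel
      rw [e, norm_smul] at this
      simpa using this
    have hY : (2:ℝ) * ‖Y‖ ≤ ‖X + Y‖ + ‖X - Y‖ := by
      have := norm_sub_le (X + Y) (X - Y)
      have e : (X + Y) - (X - Y) = (2:ℝ) • Y := by rw [two_smul]; abel
      rw [e, norm_smul] at this
      simpa using this
    refine ⟨⟨h1, ?_⟩, ⟨h2, ?_⟩, ?_⟩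
    · rw [mem_ball_zero_iff]; simp only; linarith
    · rw [mem_ball_zero_iff]; simp only; linarith
    · rw [Prod.dist_eq]
      exact max_le (by rw [Real.dist_eq]; exact h3) (by rw [dist_eq_norm]; exact h5)
  have key := hmain h h0 hhδ A (fun q hq => ⟨(hAΩ q hq).1, (hAΩ q hq).2.2⟩)
  have hball : volume (closedBall (0 : ℝ × EuclideanSpace ℝ (Fin N)) h)
      = ENNReal.ofReal (h ^ (1 + N)) * C := by
    rw [Measure.addHaar_closedBall' _ _ h0.le, hC,
      ENNReal.coe_toNNReal measure_closedBall_lt_top.ne]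
    simp [Module.finrank_prod]
  have hint : ‖∫ q in A, |w q.1 - w q.2|‖ ≤ h ^ (1 + N) * C * (ε * (2 + K)) := by
    have e1 : ‖∫ q in A, |w q.1 - w q.2|‖ₑ ≤ ENNReal.ofReal (h ^ (1 + N)) * C * (ε * (2 + K)) := by
      refine (enorm_integral_le_lintegral_enorm _).trans ?_
      rw [← hball, hK, ENNReal.coe_toNNReal hΩfin]
      refine le_trans (le_of_eq ?_) key
      apply setLIntegral_congr_fun hAm
      intro q hq
      obtain ⟨a, b, -⟩ := hAΩ q hq
      simp only [hfdef, Set.indicator_of_mem a, Set.indicator_of_mem b]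
      rw [← Real.norm_eq_abs, enorm_norm]
    have e2 := ENNReal.toReal_mono (by finiteness) e1
    simpa [ENNReal.toReal_mul, ENNReal.toReal_add, ENNReal.toReal_ofReal (pow_nonneg h0.le _)] using e2
  rw [dist_zero_right, norm_mul]
  have hp : 0 < h ^ (1 + N) := by positivity
  have hεη : (ε : ℝ) * (C * (2 + K) + 1) = η := by
    change η / (C * (2 + K) + 1) * (C * (2 + K) + 1) = η
    field_simp
  have hε' : (0:ℝ) < ε := by exact_mod_cast hε
  calc ‖1 / h ^ (1 + N)‖ * ‖∫ q in A, |w q.1 - w q.2|‖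
      ≤ (1 / h ^ (1 + N)) * (h ^ (1 + N) * C * (ε * (2 + K))) := by
        rw [Real.norm_of_nonneg (by positivity)]
        gcongr
    _ = C * (2 + K) * ε := by field_simp
    _ < η := by nlinarith
end

section
/- Let T > 0, I = [0,T], and Ω ⊆ ℝⁿ a bounded open set. Let v : I × Ω → ℝ be measurable and bounded, z : I × closure(Ω) → ℝ continuous, u = v + z on I × Ω, and k ∈ ℝ. Fix h* > 0 and an admissible test function φ, and for h ∈ (0,h*) let ψ_h be the associated doubled test function. Then lim_{h→0+} ∫_I ∫_Ω ∫_I ∫_Ω |v(t,x) + z(s,y) − k| · (∂_t ψ_h + ∂_s ψ_h)(t,x,s,y) dy ds dx dt = ∫_I ∫_Ω |u(t,x) − k| · ∂_t φ(t,x) dx dt. (Equation (29) in the proof of Theorem 4.2: the time-derivative term in the doubling-of-variables argument.) -/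
open MeasureTheory Metric Set Filter

/-- The doubled test function
`ψ_h(t,x,s,y) = φ((t+s)/2, x) · Y_h(t−s) · Π_i Y_h(x_i − y_i)`,
where `Y_h(z) = Y(z/h)/h`. -/
noncomputable def psiD (n : ℕ) (Y : ℝ → ℝ)
    (φ : ℝ → EuclideanSpace ℝ (Fin n) → ℝ)
    (h t : ℝ) (x : EuclideanSpace ℝ (Fin n)) (s : ℝ)
    (y : EuclideanSpace ℝ (Fin n)) : ℝ :=
  φ ((t + s) / 2) x * (Y ((t - s) / h) / h) *
    ∏ i : Fin n, (Y ((x i - y i) / h) / h)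

noncomputable def Kd (n : ℕ) (Y : ℝ → ℝ) (h t : ℝ) (x : EuclideanSpace ℝ (Fin n))
    (p : ℝ × EuclideanSpace ℝ (Fin n)) : ℝ :=
  (Y ((t - p.1) / h) / h) * ∏ i : Fin n, (Y ((x i - p.2 i) / h) / h)

lemma Y1_int (Y : ℝ → ℝ) (hY_int : ∫ s : ℝ, Y s = 1) (h : ℝ) (hh : 0 < h) (a : ℝ) :
    ∫ s : ℝ, Y ((a - s) / h) / h = 1 := by
  rw [integral_sub_left_eq_self (fun s => Y (s / h) / h) volume a, integral_div,
    Measure.integral_comp_div Y h, hY_int, abs_of_pos hh]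
  simp [hh.ne']

lemma Kd_int (n : ℕ) (Y : ℝ → ℝ) (hY_int : ∫ s : ℝ, Y s = 1) (h : ℝ) (hh : 0 < h) (t : ℝ)
    (x : EuclideanSpace ℝ (Fin n)) : ∫ p, Kd n Y h t x p = 1 := by
  unfold Kd
  rw [Measure.volume_eq_prod, integral_prod_mul (fun s => Y ((t - s) / h) / h)
    (fun y : EuclideanSpace ℝ (Fin n) => ∏ i : Fin n, (Y ((x i - y i) / h) / h)),
    Y1_int Y hY_int h hh, one_mul]
  have := (EuclideanSpace.volume_preserving_symm_measurableEquiv_toLp (Fin n)).integral_comp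
    (MeasurableEquiv.measurableEmbedding _)
    (fun y : Fin n → ℝ => ∏ i : Fin n, (Y ((x i - y i) / h) / h))
  refine Eq.trans this ?_
  rw [integral_fintype_prod_volume_eq_prod (fun i s => Y ((x i - s) / h) / h)]
  simp [Y1_int Y hY_int h hh]

lemma Kd_integrable (n : ℕ) (Y : ℝ → ℝ) (hY_int : ∫ s : ℝ, Y s = 1) (h : ℝ) (hh : 0 < h) (t : ℝ)
    (x : EuclideanSpace ℝ (Fin n)) : Integrable (Kd n Y h t x) := by
  by_contra hc
  have := integral_undef hc
  rw [Kd_int n Y hY_int h hh] at this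
  norm_num at this

lemma Kd_nonneg (n : ℕ) (Y : ℝ → ℝ) (hY_nn : ∀ s, 0 ≤ Y s) (h : ℝ) (hh : 0 < h) (t : ℝ)
    (x : EuclideanSpace ℝ (Fin n)) (p) : 0 ≤ Kd n Y h t x p :=
  mul_nonneg (div_nonneg (hY_nn _) hh.le)
    (Finset.prod_nonneg fun i _ => div_nonneg (hY_nn _) hh.le)

lemma Kd_supp (n : ℕ) (Y : ℝ → ℝ) (hY_supp : ∀ s : ℝ, 1 ≤ |s| → Y s = 0)
    (t : ℝ) (x : EuclideanSpace ℝ (Fin n)) (u : Set (ℝ × EuclideanSpace ℝ (Fin n)))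
    (hu : u ∈ nhds (t, x)) :
    ∃ δ > 0, ∀ h, 0 < h → h < δ → ∀ p ∉ u, Kd n Y h t x p = 0 := by
  let f : ℝ × (Fin n → ℝ) → ℝ × EuclideanSpace ℝ (Fin n) := fun q => (q.1, WithLp.toLp 2 q.2)
  have hf : Continuous f := by fun_prop
  have h1 : f ⁻¹' u ∈ nhds (t, x.ofLp) := hf.continuousAt hu
  obtain ⟨δ, hδ, hb⟩ := Metric.mem_nhds_iff.1 h1
  refine ⟨δ, hδ, fun h hh hlt p hp => ?_⟩
  by_contra hK
  apply hp
  have key : ∀ a : ℝ, Y (a / h) / h ≠ 0 → |a| < δ := by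
    intro a ha
    by_contra hc
    apply ha
    rw [hY_supp, zero_div]
    rw [abs_div, abs_of_pos hh, one_le_div hh]
    linarith
  have h2 : (p.1, p.2.ofLp) ∈ f ⁻¹' u := by
    apply hb
    unfold Kd at hK
    rw [← ne_eq, mul_ne_zero_iff, Finset.prod_ne_zero_iff] at hK
    rw [Metric.mem_ball, Prod.dist_eq, max_lt_iff, dist_pi_lt_iff hδ]
    refine ⟨?_, fun i => ?_⟩
    · rw [dist_comm]; exact key _ hK.1
    · rw [dist_comm]; exact key _ (hK.2 i (Finset.mem_univ _))
  exact h2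

lemma psi_deriv (n : ℕ) (Y : ℝ → ℝ) (hY : Differentiable ℝ Y)
    (φ : ℝ → EuclideanSpace ℝ (Fin n) → ℝ) (x : EuclideanSpace ℝ (Fin n))
    (hφ : Differentiable ℝ (fun τ => φ τ x)) (h : ℝ) (t s : ℝ) (y : EuclideanSpace ℝ (Fin n)) :
    deriv (fun τ => psiD n Y φ h τ x s y) t + deriv (fun σ => psiD n Y φ h t x σ y) s
      = Kd n Y h t x (s, y) * deriv (fun τ => φ τ x) ((t + s) / 2) := by
  unfold psiD Kd
  set P := ∏ i : Fin n, (Y ((x i - y i) / h) / h)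
  have a1 : HasDerivAt (fun τ : ℝ => φ ((τ + s) / 2) x)
      (deriv (fun τ => φ τ x) ((t + s) / 2) * (1 / 2)) t :=
    HasDerivAt.comp (h₂ := fun τ => φ τ x) t (hφ _).hasDerivAt
      (((hasDerivAt_id t).add_const s).div_const 2)
  have a2 : HasDerivAt (fun σ : ℝ => φ ((t + σ) / 2) x)
      (deriv (fun τ => φ τ x) ((t + s) / 2) * (1 / 2)) s :=
    HasDerivAt.comp (h₂ := fun τ => φ τ x) s (hφ _).hasDerivAt
      (((hasDerivAt_id s).const_add t).div_const 2)
  have b1 : HasDerivAt (fun τ : ℝ => Y ((τ - s) / h)) (deriv Y ((t - s) / h) * (1 / h)) t :=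
    HasDerivAt.comp (h₂ := Y) t (hY _).hasDerivAt
      (((hasDerivAt_id t).sub_const s).div_const h)
  have b2 : HasDerivAt (fun σ : ℝ => Y ((t - σ) / h)) (deriv Y ((t - s) / h) * (-1 / h)) s :=
    HasDerivAt.comp (h₂ := Y) s (hY _).hasDerivAt
      (((hasDerivAt_id s).const_sub t).div_const h)
  have c1 := ((a1.mul (b1.div_const h)).mul_const P).deriv
  have c2 := ((a2.mul (b2.div_const h)).mul_const P).deriv
  simp only [Pi.mul_apply] at c1 c2
  rw [c1, c2]
  ring

/-- Equation (29) in the proof of Theorem 4.2: the time-derivative term in the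
doubling-of-variables argument. -/
theorem doubling_time_derivative_term
    (n : ℕ) (T : ℝ) (hT : 0 < T)
    (Ω : Set (EuclideanSpace ℝ (Fin n))) (hΩo : IsOpen Ω)
    (hΩb : Bornology.IsBounded Ω)
    (v : ℝ → EuclideanSpace ℝ (Fin n) → ℝ)
    (hv_meas : Measurable (fun p : ℝ × EuclideanSpace ℝ (Fin n) => v p.1 p.2))
    (hv_bd : ∃ M : ℝ, ∀ t ∈ Set.Icc 0 T, ∀ x ∈ Ω, |v t x| ≤ M)
    (z : ℝ → EuclideanSpace ℝ (Fin n) → ℝ)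
    (hz_cont : ContinuousOn (fun p : ℝ × EuclideanSpace ℝ (Fin n) => z p.1 p.2)
        (Set.Icc 0 T ×ˢ closure Ω))
    (k : ℝ)
    (Y : ℝ → ℝ) (hY_smooth : ContDiff ℝ (⊤ : ℕ∞) Y) (hY_nn : ∀ s, 0 ≤ Y s)
    (hY_even : ∀ s, Y (-s) = Y s) (hY_supp : ∀ s : ℝ, 1 ≤ |s| → Y s = 0)
    (hY_int : ∫ s : ℝ, Y s = 1)
    (hstar : ℝ) (hhstar : 0 < hstar)
    (φ : ℝ → EuclideanSpace ℝ (Fin n) → ℝ)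
    (hφ_smooth : ContDiff ℝ 2 (fun p : ℝ × EuclideanSpace ℝ (Fin n) => φ p.1 p.2))
    (hφ_supp : HasCompactSupport (fun p : ℝ × EuclideanSpace ℝ (Fin n) => φ p.1 p.2))
    (hφ_nn : ∀ t x, 0 ≤ φ t x)
    (hφ_T : ∀ (t : ℝ) (x : EuclideanSpace ℝ (Fin n)), T ≤ t → φ t x = 0)
    (hφ_adm : ∀ (t : ℝ) (x : EuclideanSpace ℝ (Fin n)),
        (ball x hstar ∩ Ωᶜ).Nonempty → φ t x = 0) :
    Tendsto
      (fun h : ℝ =>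
        ∫ t in Set.Icc 0 T, ∫ x in Ω, ∫ s in Set.Icc 0 T, ∫ y in Ω,
          |v t x + z s y - k| *
            (deriv (fun τ => psiD n Y φ h τ x s y) t +
             deriv (fun σ => psiD n Y φ h t x σ y) s))
      (nhdsWithin 0 (Set.Ioo 0 hstar))
      (nhds (∫ t in Set.Icc 0 T, ∫ x in Ω,
        |v t x + z t x - k| * deriv (fun τ => φ τ x) t)) := by
  classical
  set I : Set ℝ := Set.Icc 0 T with hI
  set Φ : ℝ × EuclideanSpace ℝ (Fin n) → ℝ := fun p => φ p.1 p.2 with hΦ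
  have hΦd : Differentiable ℝ Φ := hφ_smooth.differentiable (by norm_num)
  have hφd : ∀ x, Differentiable ℝ (fun τ => φ τ x) := fun x =>
    hΦd.comp (g := Φ) (f := fun τ : ℝ => (τ, x)) (by fun_prop)
  have hYd : Differentiable ℝ Y := hY_smooth.differentiable (by simp)
  have hYc : Continuous Y := hYd.continuous
  -- the time derivative
  set D : ℝ × EuclideanSpace ℝ (Fin n) → ℝ := fun p => fderiv ℝ Φ p (1, 0) with hD
  have hDeq : ∀ t x, deriv (fun τ => φ τ x) t = D (t, x) := by
    intro t x
    have h1 : HasDerivAt (fun τ : ℝ => (τ, x)) ((1 : ℝ), (0 : EuclideanSpace ℝ (Fin n))) t :=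
      (hasDerivAt_id t).prodMk (hasDerivAt_const t x)
    exact ((hΦd (t, x)).hasFDerivAt.comp_hasDerivAt t h1).deriv
  have hDc : Continuous D :=
    (hφ_smooth.continuous_fderiv (by norm_num)).clm_apply continuous_const
  obtain ⟨C1, hC1⟩ : ∃ C, ∀ p, ‖D p‖ ≤ C := by
    refine hDc.bounded_above_of_compact_support ?_
    exact (hφ_supp.fderiv ℝ).comp_left (g := fun L : (ℝ × EuclideanSpace ℝ (Fin n)) →L[ℝ] ℝ => L (1, 0)) rfl
  obtain ⟨M, hM⟩ := hv_bd
  have hcl : IsCompact (I ×ˢ closure Ω) :=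
    isCompact_Icc.prod (Metric.isCompact_of_isClosed_isBounded isClosed_closure hΩb.closure)
  obtain ⟨C2, hC2⟩ := hcl.exists_bound_of_continuousOn hz_cont
  set w : ℝ × EuclideanSpace ℝ (Fin n) → ℝ := (I ×ˢ closure Ω).piecewise (fun p => z p.1 p.2) (fun _ => 0) with hw
  have hwm : Measurable w :=
    hz_cont.measurable_piecewise continuousOn_const hcl.isClosed.measurableSet
  have hwz : ∀ s ∈ I, ∀ y ∈ Ω, w (s, y) = z s y := fun s hs y hy =>
    Set.piecewise_eq_of_mem _ _ _ ⟨hs, subset_closure hy⟩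
  have hS : MeasurableSet (I ×ˢ Ω) := measurableSet_Icc.prod hΩo.measurableSet
  have hΩfin : volume Ω < ⊤ := hΩb.measure_lt_top
  have hSfin : volume (I ×ˢ Ω) < ⊤ :=
    lt_of_le_of_lt (measure_mono (Set.prod_mono le_rfl subset_closure)) hcl.measure_lt_top
  set C : ℝ := (|M| + |C2| + |k|) * |C1| with hC
  have hC0 : 0 ≤ C := by positivity
  -- the integrand
  let g : ℝ → EuclideanSpace ℝ (Fin n) → ℝ × EuclideanSpace ℝ (Fin n) → ℝ := fun t x p => |v t x + w p - k| * D ((t + p.1) / 2, x)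
  have hgb : ∀ t ∈ I, ∀ x ∈ Ω, ∀ p ∈ I ×ˢ Ω, ‖g t x p‖ ≤ C := by
    intro t ht x hx p hp
    simp only [g, norm_mul, hC]
    have h1 : |v t x| ≤ |M| := (hM t ht x hx).trans (le_abs_self _)
    have h2 : |w p| ≤ |C2| := by
      have := hC2 p ⟨hp.1, subset_closure hp.2⟩
      rw [show w p = z p.1 p.2 from hwz p.1 hp.1 p.2 hp.2]
      exact this.trans (le_abs_self _)
    have h3 := (hC1 ((t + p.1) / 2, x)).trans (le_abs_self _)
    rw [Real.norm_eq_abs, abs_abs]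
    refine mul_le_mul ?_ h3 (norm_nonneg _) (by positivity)
    calc |v t x + w p - k| ≤ |v t x + w p| + |k| := abs_sub _ _
      _ ≤ |v t x| + |w p| + |k| := by gcongr; exact abs_add_le _ _
      _ ≤ _ := by gcongr
  have hgm4 : Measurable (fun q : (ℝ × EuclideanSpace ℝ (Fin n)) × (ℝ × EuclideanSpace ℝ (Fin n)) => g q.1.1 q.1.2 q.2) := by
    have h1 : Measurable (fun q : (ℝ × EuclideanSpace ℝ (Fin n)) × (ℝ × EuclideanSpace ℝ (Fin n)) => v q.1.1 q.1.2) :=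
      hv_meas.comp measurable_fst
    have h2 : Measurable (fun q : (ℝ × EuclideanSpace ℝ (Fin n)) × (ℝ × EuclideanSpace ℝ (Fin n)) => w q.2) := hwm.comp measurable_snd
    have h3 : Continuous (fun q : (ℝ × EuclideanSpace ℝ (Fin n)) × (ℝ × EuclideanSpace ℝ (Fin n)) => D ((q.1.1 + q.2.1) / 2, q.1.2)) :=
      hDc.comp (by fun_prop)
    exact (continuous_abs.measurable.comp ((h1.add h2).sub_const k)).mul h3.measurable
  have hgm : ∀ t x, Measurable (g t x) := fun t x =>
    hgm4.comp (measurable_const.prodMk measurable_id : Measurable fun p : ℝ × EuclideanSpace ℝ (Fin n) => ((t, x), p))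
  have hKm4 : ∀ h, Measurable (fun q : (ℝ × EuclideanSpace ℝ (Fin n)) × (ℝ × EuclideanSpace ℝ (Fin n)) => Kd n Y h q.1.1 q.1.2 q.2) := by
    intro h
    apply Continuous.measurable
    unfold Kd
    fun_prop
  have hgi : ∀ t ∈ I, ∀ x ∈ Ω, IntegrableOn (g t x) (I ×ˢ Ω) := fun t ht x hx =>
    Measure.integrableOn_of_bounded hSfin.ne (hgm t x).aestronglyMeasurable
      ((ae_restrict_iff' hS).2 (Eventually.of_forall (hgb t ht x hx)))
  have hKgi : ∀ h, 0 < h → ∀ t ∈ I, ∀ x ∈ Ω,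
      IntegrableOn (fun p => Kd n Y h t x p * g t x p) (I ×ˢ Ω) := fun h hh t ht x hx =>
    (Kd_integrable n Y hY_int h hh t x).integrableOn.mul_bdd
      (hgm t x).aestronglyMeasurable
      ((ae_restrict_iff' hS).2 (Eventually.of_forall (hgb t ht x hx)))
  let G : ℝ → ℝ → EuclideanSpace ℝ (Fin n) → ℝ := fun h t x => ∫ p in I ×ˢ Ω, Kd n Y h t x p * g t x p
  have hGm : ∀ h, StronglyMeasurable (fun q : ℝ × EuclideanSpace ℝ (Fin n) => G h q.1 q.2) := fun h =>
    StronglyMeasurable.integral_prod_right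
      (f := fun (q : ℝ × EuclideanSpace ℝ (Fin n)) (p : ℝ × EuclideanSpace ℝ (Fin n)) => Kd n Y h q.1 q.2 p * g q.1 q.2 p)
      ((hKm4 h).mul hgm4).stronglyMeasurable
  have hGb : ∀ h, 0 < h → ∀ t ∈ I, ∀ x ∈ Ω, ‖G h t x‖ ≤ C := by
    intro h hh t ht x hx
    have hKi := Kd_integrable n Y hY_int h hh t x
    calc ‖G h t x‖ ≤ ∫ p in I ×ˢ Ω, Kd n Y h t x p * C := by
          refine norm_integral_le_of_norm_le (hKi.integrableOn.mul_const C) ?_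
          refine (ae_restrict_iff' hS).2 (Eventually.of_forall fun p hp => ?_)
          have h0 := Kd_nonneg n Y hY_nn h hh t x p
          rw [norm_mul, Real.norm_of_nonneg h0]
          exact mul_le_mul_of_nonneg_left (hgb t ht x hx p hp) h0
      _ = (∫ p in I ×ˢ Ω, Kd n Y h t x p) * C := integral_mul_const _ _
      _ ≤ (∫ p, Kd n Y h t x p) * C := by
          refine mul_le_mul_of_nonneg_right ?_ hC0
          exact setIntegral_le_integral hKi
            (Eventually.of_forall (Kd_nonneg n Y hY_nn h hh t x))
      _ = C := by rw [Kd_int n Y hY_int h hh, one_mul]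
  have hpos : ∀ᶠ h in nhdsWithin (0 : ℝ) (Set.Ioo 0 hstar), 0 < h :=
    eventually_nhdsWithin_of_forall fun h hh => hh.1
  have hlt : ∀ δ > 0, ∀ᶠ h in nhdsWithin (0 : ℝ) (Set.Ioo 0 hstar), h < δ := fun δ hδ =>
    nhdsWithin_le_nhds (Iio_mem_nhds hδ)
  -- pointwise convergence
  have hptw : ∀ t ∈ Set.Ioo 0 T, ∀ x ∈ Ω, Tendsto (fun h => G h t x)
      (nhdsWithin 0 (Set.Ioo 0 hstar)) (nhds (|v t x + z t x - k| * D (t, x))) := by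
    intro t ht x hx
    have htI : t ∈ I := Set.Ioo_subset_Icc_self ht
    have hSn : I ×ˢ Ω ∈ nhds (t, x) :=
      prod_mem_nhds (Icc_mem_nhds ht.1 ht.2) (hΩo.mem_nhds hx)
    refine tendsto_setIntegral_peak_smul_of_integrableOn_of_tendsto (x₀ := (t, x)) (g := g t x)
      (φ := fun h => Kd n Y h t x) hS hS le_rfl self_mem_nhdsWithin hSfin.ne ?_ ?_ ?_ ?_
      (hgi t htI x hx) ?_
    · filter_upwards [hpos] with h hh p _ using Kd_nonneg n Y hY_nn h hh t x p
    · intro u hu hxu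
      obtain ⟨δ, hδ, hs⟩ := Kd_supp n Y hY_supp t x u (hu.mem_nhds hxu)
      rw [Metric.tendstoUniformlyOn_iff]
      intro ε hε
      filter_upwards [hpos, hlt δ hδ] with h hh hhδ p hp
      rw [hs h hh hhδ p hp.2]
      simpa using hε
    · obtain ⟨δ, hδ, hs⟩ := Kd_supp n Y hY_supp t x _ hSn
      refine tendsto_const_nhds.congr' ?_
      filter_upwards [hpos, hlt δ hδ] with h hh hhδ
      rw [setIntegral_eq_integral_of_forall_compl_eq_zero (hs h hh hhδ), Kd_int n Y hY_int h hh]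
    · filter_upwards [hpos] with h hh
      exact (Kd_integrable n Y hY_int h hh t x).aestronglyMeasurable.restrict
    · have hzc : Tendsto (fun p : ℝ × EuclideanSpace ℝ (Fin n) => z p.1 p.2) (nhdsWithin (t, x) (I ×ˢ Ω))
          (nhds (z t x)) :=
        (hz_cont (t, x) ⟨htI, subset_closure hx⟩).mono (Set.prod_mono le_rfl subset_closure)
      have hwc : Tendsto w (nhdsWithin (t, x) (I ×ˢ Ω)) (nhds (z t x)) := by
        refine hzc.congr' ?_
        filter_upwards [self_mem_nhdsWithin] with p hp
        exact (hwz p.1 hp.1 p.2 hp.2).symm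
      have hDt : Tendsto (fun p : ℝ × EuclideanSpace ℝ (Fin n) => D ((t + p.1) / 2, x)) (nhdsWithin (t, x) (I ×ˢ Ω))
          (nhds (D (t, x))) := by
        have hcc : Continuous (fun p : ℝ × EuclideanSpace ℝ (Fin n) => D ((t + p.1) / 2, x)) := hDc.comp (by fun_prop)
        have := hcc.tendsto (t, x)
        simp only [add_self_div_two] at this
        exact this.mono_left nhdsWithin_le_nhds
      exact (((hwc.const_add (v t x)).sub_const k).abs).mul hDt
  -- rewriting the left-hand side
  have hL : ∀ h, 0 < h → (∫ t in I, ∫ x in Ω, ∫ s in I, ∫ y in Ω,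
      |v t x + z s y - k| * (deriv (fun τ => psiD n Y φ h τ x s y) t +
        deriv (fun σ => psiD n Y φ h t x σ y) s)) = ∫ t in I, ∫ x in Ω, G h t x := by
    intro h hh
    refine setIntegral_congr_fun measurableSet_Icc fun t ht => ?_
    refine setIntegral_congr_fun hΩo.measurableSet fun x hx => ?_
    have := setIntegral_prod (μ := (volume : Measure ℝ)) (ν := (volume : Measure (EuclideanSpace ℝ (Fin n)))) _
      (hKgi h hh t ht x hx)
    refine Eq.trans ?_ this.symm
    refine setIntegral_congr_fun measurableSet_Icc fun s hs => ?_
    refine setIntegral_congr_fun hΩo.measurableSet fun y hy => ?_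
    simp only [g]
    rw [psi_deriv n Y hYd φ x (hφd x), hDeq, hwz s hs y hy]
    ring
  have hR : (∫ t in I, ∫ x in Ω, |v t x + z t x - k| * deriv (fun τ => φ τ x) t)
      = ∫ t in I, ∫ x in Ω, |v t x + z t x - k| * D (t, x) := by
    simp only [hDeq]
  rw [hR]
  have hmain : Tendsto (fun h => ∫ t in I, ∫ x in Ω, G h t x)
      (nhdsWithin 0 (Set.Ioo 0 hstar))
      (nhds (∫ t in I, ∫ x in Ω, |v t x + z t x - k| * D (t, x))) := by
    have hIfin : volume I < ⊤ := isCompact_Icc.measure_lt_top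
    refine tendsto_integral_filter_of_dominated_convergence
      (fun _ => C * (volume : Measure (EuclideanSpace ℝ (Fin n))).real Ω) ?_ ?_ ?_ ?_
    · refine Eventually.of_forall fun h => ?_
      exact (StronglyMeasurable.integral_prod_right (f := fun (t : ℝ) (x : EuclideanSpace ℝ (Fin n)) => G h t x)
        (hGm h)).aestronglyMeasurable
    · filter_upwards [hpos] with h hh
      refine (ae_restrict_iff' measurableSet_Icc).2 (Eventually.of_forall fun t ht => ?_)
      exact norm_setIntegral_le_of_norm_le_const hΩfin (hGb h hh t ht)
    · exact integrableOn_const hIfin.ne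
    · rw [hI, ← restrict_Ioo_eq_restrict_Icc]
      refine (ae_restrict_iff' measurableSet_Ioo).2 (Eventually.of_forall fun t ht => ?_)
      refine tendsto_integral_filter_of_dominated_convergence (fun _ => C) ?_ ?_ ?_ ?_
      · refine Eventually.of_forall fun h => ?_
        exact ((hGm h).comp_measurable
          (measurable_const.prodMk measurable_id :
            Measurable fun x : EuclideanSpace ℝ (Fin n) => (t, x))).aestronglyMeasurable
      · filter_upwards [hpos] with h hh
        exact (ae_restrict_iff' hΩo.measurableSet).2
          (Eventually.of_forall (hGb h hh t (Set.Ioo_subset_Icc_self ht)))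
      · exact integrableOn_const hΩfin.ne
      · exact (ae_restrict_iff' hΩo.measurableSet).2 (Eventually.of_forall (hptw t ht))
  refine hmain.congr' ?_
  filter_upwards [hpos] with h hh using (hL h hh).symm
end

section
/- Let T > 0, I = [0,T], and Ω ⊆ ℝⁿ a bounded open set. Let f : I × closure(Ω) × ℝ → ℝⁿ be of class C², and write div_x f(t,x,w) = Σᵢ ∂_{x_i} f_i(t,x,w) for the divergence in x at fixed last argument w. Let v : I × Ω → ℝ be measurable and bounded, z : I × closure(Ω) → ℝ continuous, u = v + z on I × Ω, and k ∈ ℝ. Fix h* > 0 and an admissible test function φ, and for h ∈ (0,h*) let ψ_h be the associated doubled test function. Then lim_{h→0+} ∫_I ∫_Ω ∫_I ∫_Ω sgn(v(t,x) + z(s,y) − k) · div_x f(t,x, z(t,x) − z(s,y) + k) · ψ_h(t,x,s,y) dy ds dx dt = ∫_I ∫_Ω sgn(u(t,x) − k) · div_x f(t,x,k) · φ(t,x) dx dt. (Equation (e2) in the proof of Theorem 4.2: the divergence term in the doubling-of-variables argument.) -/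
open MeasureTheory Metric Set Filter

/-- The divergence in `x`, at fixed last argument, of a field
`g : ℝⁿ → ℝⁿ` at the point `x`. -/
noncomputable def divX (n : ℕ)
    (g : EuclideanSpace ℝ (Fin n) → EuclideanSpace ℝ (Fin n))
    (x : EuclideanSpace ℝ (Fin n)) : ℝ :=
  ∑ i : Fin n, fderiv ℝ (fun y => g y i) x (EuclideanSpace.single i 1)

section abs
variable {V : Type*} [NormedAddCommGroup V] [NormedSpace ℝ V] [FiniteDimensional ℝ V]
  [MeasurableSpace V] [BorelSpace V] (μ : Measure V) [μ.IsAddHaarMeasure]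

noncomputable def rhoH (ρ : V → ℝ) (h : ℝ) (x : V) : ℝ :=
  (h ^ Module.finrank ℝ V)⁻¹ * ρ (h⁻¹ • x)

theorem cov_aux (ρ : V → ℝ) (B : Set V) (hB : MeasurableSet B) (K : V → ℝ) (p : V) (h : ℝ) (hh : 0 < h) :
    ∫ q in B, K q * rhoH ρ h (p - q) ∂μ = ∫ w, B.indicator K (p - h • w) * ρ w ∂μ := by
  have h1 := Measure.integral_comp_smul μ (fun x => B.indicator K (p - x) * ρ (h⁻¹ • x)) h
  have h2 : ∀ w : V, h⁻¹ • h • w = w := fun w => inv_smul_smul₀ hh.ne' w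
  simp only [h2] at h1
  rw [h1, ← integral_indicator hB]
  have h3 := integral_sub_left_eq_self (fun x => B.indicator K (p - x) * ρ (h⁻¹ • x)) μ p
  rw [← h3, smul_eq_mul, ← integral_const_mul]
  congr 1
  ext q
  have : 0 < (h ^ Module.finrank ℝ V)⁻¹ := by positivity
  rw [abs_of_pos this]
  by_cases hq : q ∈ B <;> simp [hq, rhoH]
  ring

theorem int_aux (ρ : V → ℝ) (hρ : Continuous ρ) (M : ℝ) (hM : ∀ x, |ρ x| ≤ M) (B : Set V)
    (hB : MeasurableSet B) (hfin : μ B ≠ ⊤) (K : V → V → ℝ)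
    (hK : Measurable (fun x : V × V => K x.1 x.2)) (C : ℝ)
    (hC : ∀ p ∈ B, ∀ q ∈ B, |K p q| ≤ C) (h : ℝ) :
    Integrable (fun x : V × V => K x.1 x.2 * rhoH ρ h (x.1 - x.2))
      ((μ.restrict B).prod (μ.restrict B)) := by
  have : IsFiniteMeasure (μ.restrict B) := ⟨by simpa [lt_top_iff_ne_top] using hfin⟩
  have hm : Measurable (fun x : V × V => rhoH ρ h (x.1 - x.2)) := by
    unfold rhoH
    have : Continuous (fun x : V × V => (h ^ Module.finrank ℝ V)⁻¹ * ρ (h⁻¹ • (x.1 - x.2))) := by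
      fun_prop
    exact this.measurable
  refine Integrable.of_bound (hK.mul hm).aestronglyMeasurable (C * (|(h ^ Module.finrank ℝ V)⁻¹| * M)) ?_
  rw [Measure.prod_restrict]
  filter_upwards [ae_restrict_mem (hB.prod hB)] with x hx
  rw [Real.norm_eq_abs, abs_mul]
  unfold rhoH
  rw [abs_mul]
  have h1 := hC x.1 hx.1 x.2 hx.2
  have h2 := hM (h⁻¹ • (x.1 - x.2))
  have := abs_nonneg (K x.1 x.2)
  gcongr
  linarith

theorem int_aux2 (ρ : V → ℝ) (hρ : Continuous ρ) (M : ℝ) (hM : ∀ x, |ρ x| ≤ M) (B : Set V)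
    (hB : MeasurableSet B) (hfin : μ B ≠ ⊤) (K : V → ℝ)
    (hK : Measurable K) (C : ℝ)
    (hC : ∀ q ∈ B, |K q| ≤ C) (h : ℝ) (p : V) :
    IntegrableOn (fun q : V => K q * rhoH ρ h (p - q)) B μ := by
  have : IsFiniteMeasure (μ.restrict B) := ⟨by simpa [lt_top_iff_ne_top] using hfin⟩
  have hm : Measurable (fun q : V => rhoH ρ h (p - q)) := by
    unfold rhoH
    have : Continuous (fun q : V => (h ^ Module.finrank ℝ V)⁻¹ * ρ (h⁻¹ • (p - q))) := by
      fun_prop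
    exact this.measurable
  refine Integrable.of_bound (hK.mul hm).aestronglyMeasurable (C * (|(h ^ Module.finrank ℝ V)⁻¹| * M)) ?_
  filter_upwards [ae_restrict_mem hB] with x hx
  rw [Real.norm_eq_abs, abs_mul]
  unfold rhoH
  rw [abs_mul]
  have h1 := hC x hx
  have h2 := hM (h⁻¹ • (p - x))
  have := abs_nonneg (K x)
  gcongr
  linarith

theorem lim_aux (ρ : V → ℝ) (hρ : Continuous ρ) (hρi : Integrable ρ μ) (hρ0 : ∀ x, 0 ≤ ρ x)
    (hρ1 : ∫ x, ρ x ∂μ = 1) (B : Set V)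
    (hB : IsOpen B) (hfin : μ B ≠ ⊤) (K : V → V → ℝ)
    (hK : Measurable (fun x : V × V => K x.1 x.2)) (C : ℝ)
    (hC : ∀ p ∈ B, ∀ q ∈ B, |K p q| ≤ C) (l : V → ℝ)
    (hl : ∀ p ∈ B, Tendsto (fun q => K p q) (nhds p) (nhds (l p))) :
    Tendsto (fun h => ∫ p in B, ∫ q in B, K p q * rhoH ρ h (p - q) ∂μ ∂μ)
      (nhdsWithin 0 (Ioi 0)) (nhds (∫ p in B, l p ∂μ)) := by
  have : IsFiniteMeasure (μ.restrict B) := ⟨by simpa [lt_top_iff_ne_top] using hfin⟩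
  have hmK : ∀ p, Measurable (K p) := fun p => hK.comp measurable_prodMk_left
  have hbd : ∀ p ∈ B, ∀ x, |B.indicator (K p) x| ≤ C := by
    intro p hp x
    have h0 := (abs_nonneg _).trans (hC p hp p hp)
    by_cases hx : x ∈ B
    · simpa [hx] using hC p hp x hx
    · simpa [hx] using h0
  have hb2 : ∀ (h : ℝ) (p : V), p ∈ B → ∀ w, ‖B.indicator (K p) (p - h • w) * ρ w‖ ≤ C * ρ w := by
    intro h p hp w
    rw [Real.norm_eq_abs, abs_mul, abs_of_nonneg (hρ0 w)]
    exact mul_le_mul_of_nonneg_right (hbd p hp _) (hρ0 w)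
  refine tendsto_integral_filter_of_dominated_convergence (fun _ => C) ?_ ?_ (integrable_const _) ?_
  · refine Eventually.of_forall fun h => ?_
    refine StronglyMeasurable.aestronglyMeasurable ?_
    have : StronglyMeasurable (fun x : V × V => K x.1 x.2 * rhoH ρ h (x.1 - x.2)) := by
      refine Measurable.stronglyMeasurable (hK.mul ?_)
      unfold rhoH
      have : Continuous (fun x : V × V => (h ^ Module.finrank ℝ V)⁻¹ * ρ (h⁻¹ • (x.1 - x.2))) := by
        fun_prop
      exact this.measurable
    exact this.integral_prod_right
  · filter_upwards [self_mem_nhdsWithin] with h hh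
    filter_upwards [ae_restrict_mem hB.measurableSet] with p hp
    rw [cov_aux μ ρ B hB.measurableSet (K p) p h hh]
    refine (norm_integral_le_of_norm_le (hρi.const_mul C) (Eventually.of_forall (hb2 h p hp))).trans ?_
    rw [integral_const_mul, hρ1, mul_one]
  · filter_upwards [ae_restrict_mem hB.measurableSet] with p hp
    have e : l p = ∫ w, l p * ρ w ∂μ := by rw [integral_const_mul, hρ1, mul_one]
    rw [e]
    have : Tendsto (fun h : ℝ => ∫ w, B.indicator (K p) (p - h • w) * ρ w ∂μ)
      (nhdsWithin 0 (Ioi 0)) (nhds (∫ w, l p * ρ w ∂μ)) := by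
      refine tendsto_integral_filter_of_dominated_convergence (fun w => C * ρ w) ?_ ?_
        (hρi.const_mul C) ?_
      · refine Eventually.of_forall fun h => ?_
        refine Measurable.aestronglyMeasurable ?_
        refine Measurable.mul ?_ hρ.measurable
        refine ((hmK p).indicator hB.measurableSet).comp ?_
        have : Continuous (fun w : V => p - h • w) := by fun_prop
        exact this.measurable
      · exact Eventually.of_forall fun h => Eventually.of_forall (hb2 h p hp)
      · refine Eventually.of_forall fun w => Tendsto.mul_const _ ?_
        have t1 : Tendsto (fun h : ℝ => p - h • w) (nhdsWithin 0 (Ioi 0)) (nhds p) := by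
          have : Continuous (fun h : ℝ => p - h • w) := by fun_prop
          have := this.tendsto 0
          simp only [zero_smul, sub_zero] at this
          exact this.mono_left nhdsWithin_le_nhds
        have t2 : Tendsto (B.indicator (K p)) (nhds p) (nhds (l p)) := by
          refine (hl p hp).congr' ?_
          filter_upwards [hB.mem_nhds hp] with q hq
          simp [hq]
        exact t2.comp t1
    refine this.congr' ?_
    filter_upwards [self_mem_nhdsWithin] with h hh
    rw [cov_aux μ ρ B hB.measurableSet (K p) p h hh]

theorem sign_abs_le (r : ℝ) : |Real.sign r| ≤ 1 := by
  rcases Real.sign_apply_eq r with h | h | h <;> simp [h]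

theorem sign_meas : Measurable Real.sign := by
  unfold Real.sign
  exact Measurable.ite measurableSet_Iio measurable_const
    (Measurable.ite measurableSet_Ioi measurable_const measurable_const)

theorem sign_tendsto {r : ℝ} (hr : r ≠ 0) : Tendsto Real.sign (nhds r) (nhds (Real.sign r)) := by
  rcases lt_or_gt_of_ne hr with h | h
  · refine tendsto_const_nhds.congr' ?_
    filter_upwards [Iio_mem_nhds h] with x hx
    rw [Real.sign_of_neg h, Real.sign_of_neg hx]
  · refine tendsto_const_nhds.congr' ?_
    filter_upwards [Ioi_mem_nhds h] with x hx
    rw [Real.sign_of_pos h, Real.sign_of_pos hx]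

theorem anti_aux (ρ : V → ℝ) (hρ : Continuous ρ) (hρi : Integrable ρ μ) (hρ0 : ∀ x, 0 ≤ ρ x)
    (hρe : ∀ x, ρ (-x) = ρ x) (M : ℝ) (hM : ∀ x, |ρ x| ≤ M)
    (hρ1 : ∫ x, ρ x ∂μ = 1) (B : Set V)
    (hB : IsOpen B) (hfin : μ B ≠ ⊤) (z : V → ℝ) (hz : Continuous z)
    (c : V → ℝ) (hc : Measurable c) (C : ℝ) (hC : ∀ p, |c p| ≤ C) :
    Tendsto (fun h => ∫ p in B, ∫ q in B, (c p * Real.sign (z q - z p)) * rhoH ρ h (p - q) ∂μ ∂μ)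
      (nhdsWithin 0 (Ioi 0)) (nhds 0) := by
  have : IsFiniteMeasure (μ.restrict B) := ⟨by simpa [lt_top_iff_ne_top] using hfin⟩
  have hsm : Measurable (fun x : V × V => Real.sign (z x.2 - z x.1)) :=
    sign_meas.comp (by fun_prop : Continuous (fun x : V × V => z x.2 - z x.1)).measurable
  have hci : Integrable c (μ.restrict B) :=
    Integrable.of_bound hc.aestronglyMeasurable C (Eventually.of_forall hC)
  rw [Metric.tendsto_nhds]
  intro ε hε
  obtain ⟨g, hgs, hgε, hgc, hgi⟩ := hci.exists_hasCompactSupport_integral_sub_le (half_pos hε)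
  obtain ⟨D, hD⟩ := hgs.exists_bound_of_continuous hgc
  have hD' : ∀ x, |g x| ≤ D := hD
  -- integrability
  have i1 := fun h => int_aux μ ρ hρ M hM B hB.measurableSet hfin
    (fun p q => c p * Real.sign (z q - z p)) ((hc.comp measurable_fst).mul hsm) C
    (fun p _ q _ => by
      rw [abs_mul]; nlinarith [hC p, sign_abs_le (z q - z p), abs_nonneg (c p), abs_nonneg (Real.sign (z q - z p))]) h
  have i2 := fun h => int_aux μ ρ hρ M hM B hB.measurableSet hfin
    (fun p q => g p * Real.sign (z q - z p)) ((hgc.measurable.comp measurable_fst).mul hsm) D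
    (fun p _ q _ => by
      rw [abs_mul]; nlinarith [hD' p, sign_abs_le (z q - z p), abs_nonneg (g p), abs_nonneg (Real.sign (z q - z p))]) h
  have hK3m : Measurable (fun x : V × V => (g x.1 - g x.2) * Real.sign (z x.2 - z x.1)) :=
    ((hgc.measurable.comp measurable_fst).sub (hgc.measurable.comp measurable_snd)).mul hsm
  have hK3b : ∀ p ∈ B, ∀ q ∈ B, |(g p - g q) * Real.sign (z q - z p)| ≤ 2 * D := by
    intro p _ q _
    rw [abs_mul]
    have h1 : |g p - g q| ≤ 2 * D := by
      have := abs_sub (g p) (g q)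
      linarith [hD' p, hD' q]
    nlinarith [sign_abs_le (z q - z p), abs_nonneg (g p - g q), abs_nonneg (Real.sign (z q - z p))]
  have l3 := lim_aux μ ρ hρ hρi hρ0 hρ1 B hB hfin (fun p q => (g p - g q) * Real.sign (z q - z p))
    hK3m (2 * D) hK3b (fun _ => 0) (fun p _ => by
      refine squeeze_zero_norm (a := fun q => |g p - g q|) (fun q => ?_) ?_
      · rw [Real.norm_eq_abs, abs_mul]
        nlinarith [sign_abs_le (z q - z p), abs_nonneg (g p - g q), abs_nonneg (Real.sign (z q - z p))]
      · have : Continuous (fun q => |g p - g q|) := by fun_prop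
        simpa using this.tendsto p)
  simp only [integral_zero] at l3
  have hl3 := (Metric.tendsto_nhds.1 l3) ε hε
  filter_upwards [hl3, self_mem_nhdsWithin] with h h3 hh
  have hh : 0 < h := hh
  rw [Real.dist_eq, sub_zero] at h3 ⊢
  have hrn : ∀ x, 0 ≤ rhoH ρ h x := fun x => mul_nonneg (by positivity) (hρ0 _)
  have hre : ∀ x y, rhoH ρ h (x - y) = rhoH ρ h (y - x) := by
    intro x y
    unfold rhoH
    rw [← hρe, ← smul_neg, neg_sub]
  -- antisymmetry
  have e3 : ∫ p in B, ∫ q in B, ((g p - g q) * Real.sign (z q - z p)) * rhoH ρ h (p - q) ∂μ ∂μ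
      = 2 * ∫ p in B, ∫ q in B, (g p * Real.sign (z q - z p)) * rhoH ρ h (p - q) ∂μ ∂μ := by
    have i3 := int_aux μ ρ hρ M hM B hB.measurableSet hfin _ hK3m (2 * D) hK3b h
    have s := (integral_prod _ i3).symm
    have s2 := (integral_prod _ (i2 h)).symm
    have sw := integral_prod_swap (μ := μ.restrict B) (ν := μ.restrict B)
      (fun x : V × V => (g x.1 * Real.sign (z x.2 - z x.1)) * rhoH ρ h (x.1 - x.2))
    have i2s := (i2 h).swap
    simp only [Function.comp_def] at i2s
    dsimp only at s s2
    rw [s, s2, two_mul]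
    nth_rewrite 2 [← sw]
    rw [← integral_add (i2 h) i2s]
    congr 1
    ext x
    simp only [Prod.fst_swap, Prod.snd_swap]
    rw [hre x.2 x.1, ← neg_sub (z x.2) (z x.1), Real.sign_neg]
    ring
  have e1 : |(∫ p in B, ∫ q in B, (c p * Real.sign (z q - z p)) * rhoH ρ h (p - q) ∂μ ∂μ)
      - ∫ p in B, ∫ q in B, (g p * Real.sign (z q - z p)) * rhoH ρ h (p - q) ∂μ ∂μ| ≤ ε / 2 := by
    rw [← integral_sub (i1 h).integral_prod_left (i2 h).integral_prod_left, ← Real.norm_eq_abs]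
    refine le_trans (norm_integral_le_of_norm_le (g := fun x => ‖c x - g x‖) (hci.sub hgi).norm ?_) hgε
    filter_upwards with p
    have q1 : ∀ a : ℝ, ∫ q in B, a * Real.sign (z q - z p) * rhoH ρ h (p - q) ∂μ =
       a * ∫ q in B, Real.sign (z q - z p) * rhoH ρ h (p - q) ∂μ := by
      intro a
      rw [← integral_const_mul]
      simp only [mul_assoc]
    simp only [q1]
    rw [← sub_mul, norm_mul]
    refine mul_le_of_le_one_right (norm_nonneg _) ?_
    rw [cov_aux μ ρ B hB.measurableSet (fun q => Real.sign (z q - z p)) p h hh, ← hρ1]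
    refine norm_integral_le_of_norm_le hρi (Eventually.of_forall fun w => ?_)
    rw [Real.norm_eq_abs, abs_mul, abs_of_nonneg (hρ0 w)]
    refine mul_le_of_le_one_left (hρ0 w) ?_
    by_cases hx : p - h • w ∈ B
    · simpa [hx] using sign_abs_le _
    · simp [hx]
  rw [e3, abs_mul, abs_two] at h3
  rw [abs_le] at e1
  rw [abs_lt]
  have h4 := abs_lt.1 (show |∫ p in B, ∫ q in B, (g p * Real.sign (z q - z p)) * rhoH ρ h (p - q) ∂μ ∂μ| < ε / 2 by linarith)
  constructor <;> linarith [h4.1, h4.2, e1.1, e1.2]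

theorem abs_main (ρ : V → ℝ) (hρ : Continuous ρ) (hρi : Integrable ρ μ) (hρ0 : ∀ x, 0 ≤ ρ x)
    (hρe : ∀ x, ρ (-x) = ρ x) (M : ℝ) (hM : ∀ x, |ρ x| ≤ M)
    (hρ1 : ∫ x, ρ x ∂μ = 1) (B : Set V)
    (hB : IsOpen B) (hfin : μ B ≠ ⊤) (z : V → ℝ) (hz : Continuous z)
    (v : V → ℝ) (hv : Measurable v) (k : ℝ) (H : V → V → ℝ)
    (hH : Continuous (fun x : V × V => H x.1 x.2)) (C : ℝ)
    (hC : ∀ p ∈ B, ∀ q ∈ B, |H p q| ≤ C) :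
    Tendsto (fun h => ∫ p in B, ∫ q in B, (Real.sign (v p + z q - k) * H p q) * rhoH ρ h (p - q) ∂μ ∂μ)
      (nhdsWithin 0 (Ioi 0)) (nhds (∫ p in B, Real.sign (v p + z p - k) * H p p ∂μ)) := by
  classical
  have : IsFiniteMeasure (μ.restrict B) := ⟨by simpa [lt_top_iff_ne_top] using hfin⟩
  rcases B.eq_empty_or_nonempty with rfl | ⟨b, hb⟩
  · simp
  have hC0 : 0 ≤ C := (abs_nonneg _).trans (hC b hb b hb)
  have hsm : Measurable (fun x : V × V => Real.sign (z x.2 - z x.1)) :=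
    sign_meas.comp (by fun_prop : Continuous (fun x : V × V => z x.2 - z x.1)).measurable
  have hsv : Measurable (fun x : V × V => Real.sign (v x.1 + z x.2 - k)) :=
    sign_meas.comp (((hv.comp measurable_fst).add (hz.measurable.comp measurable_snd)).sub_const k)
  have hHd : Continuous (fun p => H p p) := hH.comp (by fun_prop : Continuous fun p : V => (p, p))
  set E : Set V := B ∩ {p | v p + z p - k = 0} with hE
  have hEm : MeasurableSet E := hB.measurableSet.inter
    (((hv.add hz.measurable).sub_const k) (measurableSet_singleton 0))
  set c : V → ℝ := E.indicator (fun p => H p p) with hcdef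
  have hcm : Measurable c := hHd.measurable.indicator hEm
  have hcb : ∀ p, |c p| ≤ C := by
    intro p
    by_cases hp : p ∈ E
    · simpa [hcdef, hp] using hC p hp.1 p hp.1
    · simpa [hcdef, hp] using hC0
  have A := anti_aux μ ρ hρ hρi hρ0 hρe M hM hρ1 B hB hfin z hz c hcm C hcb
  have mul1 : ∀ a s : ℝ, |a| ≤ C → |s| ≤ 1 → |a * s| ≤ C := by
    intro a s h1 h2
    rw [abs_mul]; nlinarith [abs_nonneg a, abs_nonneg s]
  have hK1m : Measurable (fun x : V × V => Real.sign (v x.1 + z x.2 - k) * H x.1 x.2) :=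
    hsv.mul hH.measurable
  have hK2m : Measurable (fun x : V × V => c x.1 * Real.sign (z x.2 - z x.1)) :=
    (hcm.comp measurable_fst).mul hsm
  have hK1b : ∀ p ∈ B, ∀ q ∈ B, |Real.sign (v p + z q - k) * H p q| ≤ C := fun p hp q hq => by
    rw [mul_comm]; exact mul1 _ _ (hC p hp q hq) (sign_abs_le _)
  have hK2b : ∀ p ∈ B, ∀ q ∈ B, |c p * Real.sign (z q - z p)| ≤ C := fun p hp q hq =>
    mul1 _ _ (hcb p) (sign_abs_le _)
  have L := lim_aux μ ρ hρ hρi hρ0 hρ1 B hB hfin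
    (fun p q => Real.sign (v p + z q - k) * H p q - c p * Real.sign (z q - z p))
    (hK1m.sub hK2m) (2 * C) (fun p hp q hq => by
      have := abs_sub (Real.sign (v p + z q - k) * H p q) (c p * Real.sign (z q - z p))
      linarith [hK1b p hp q hq, hK2b p hp q hq])
    (fun p => Real.sign (v p + z p - k) * H p p) (fun p hp => by
      have hHp : Continuous (fun q => H p q) := hH.comp (by fun_prop : Continuous fun q : V => (p, q))
      by_cases h0 : v p + z p - k = 0
      · have hpE : p ∈ E := ⟨hp, h0⟩
        have hcp : c p = H p p := by simp [hcdef, hpE]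
        rw [h0, Real.sign_zero, zero_mul]
        refine squeeze_zero_norm (a := fun q => |H p q - H p p|) (fun q => ?_) ?_
        · have : v p + z q - k = z q - z p := by linarith
          rw [this, hcp, mul_comm (H p p), ← mul_sub, Real.norm_eq_abs, abs_mul]
          exact mul_le_of_le_one_left (abs_nonneg _) (sign_abs_le _)
        · have : Continuous (fun q => |H p q - H p p|) := by fun_prop
          simpa using this.tendsto p
      · have hcp : c p = 0 := by simp [hcdef, hE, h0]
        simp only [hcp, zero_mul, sub_zero]
        refine Tendsto.mul ?_ (hHp.tendsto p)
        have : Continuous (fun q => v p + z q - k) := by fun_prop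
        exact (sign_tendsto h0).comp (this.tendsto p))
  have S := L.add A
  rw [add_zero] at S
  refine S.congr fun h => ?_
  have j1 := int_aux μ ρ hρ M hM B hB.measurableSet hfin _ hK1m C hK1b h
  have j2 := int_aux μ ρ hρ M hM B hB.measurableSet hfin _ hK2m C hK2b h
  have s1 := (integral_prod _ j1).symm
  dsimp only at s1
  have s2 := (integral_prod _ j2).symm
  dsimp only at s2
  have j3 := j1.sub j2
  have e : ((fun x : V × V => Real.sign (v x.1 + z x.2 - k) * H x.1 x.2 * rhoH ρ h (x.1 - x.2)) -
      fun x : V × V => c x.1 * Real.sign (z x.2 - z x.1) * rhoH ρ h (x.1 - x.2)) =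
      fun x : V × V => (Real.sign (v x.1 + z x.2 - k) * H x.1 x.2 - c x.1 * Real.sign (z x.2 - z x.1)) * rhoH ρ h (x.1 - x.2) := by
    ext x; simp only [Pi.sub_apply]; ring
  rw [e] at j3
  have s3 := (integral_prod _ j3).symm
  dsimp only at s3
  rw [s1, s2, s3, ← integral_add j3 j2]
  congr 1
  ext x
  ring
end abs

theorem tietze_aux {X : Type*} [TopologicalSpace X] [NormalSpace X] {S : Set X} (hS : IsClosed S)
    (g : X → ℝ) (hg : ContinuousOn g S) : ∃ g' : X → ℝ, Continuous g' ∧ ∀ x ∈ S, g' x = g x := by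
  obtain ⟨G, hG⟩ := ContinuousMap.exists_restrict_eq hS ⟨S.domRestrict g, hg.domRestrict⟩
  exact ⟨G, G.continuous, fun x hx => congrArg (fun F : C(S, ℝ) => F ⟨x, hx⟩) hG⟩

theorem divX_aux (n : ℕ) (T : ℝ) (hT : 0 < T)
    (Ω : Set (EuclideanSpace ℝ (Fin n))) (hΩo : IsOpen Ω)
    (f : ℝ → EuclideanSpace ℝ (Fin n) → ℝ → EuclideanSpace ℝ (Fin n))
    (hf : ContDiffOn ℝ 2
        (fun p : ℝ × EuclideanSpace ℝ (Fin n) × ℝ => f p.1 p.2.1 p.2.2)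
        (Set.Icc 0 T ×ˢ closure Ω ×ˢ Set.univ)) :
    ContinuousOn (fun p : ℝ × EuclideanSpace ℝ (Fin n) × ℝ => divX n (fun ξ => f p.1 ξ p.2.2) p.2.1)
      (Set.Icc 0 T ×ˢ Ω ×ˢ Set.univ) := by
  set S : Set (ℝ × EuclideanSpace ℝ (Fin n) × ℝ) := Set.Icc 0 T ×ˢ Ω ×ˢ Set.univ with hS
  set F := fun p : ℝ × EuclideanSpace ℝ (Fin n) × ℝ => f p.1 p.2.1 p.2.2 with hF
  have hf' : ContDiffOn ℝ 2 F S := hf.mono (by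
    rintro ⟨t, x, w⟩ ⟨h1, h2, h3⟩
    exact ⟨h1, subset_closure h2, h3⟩)
  have hu : UniqueDiffOn ℝ S :=
    (uniqueDiffOn_Icc hT).prod (hΩo.uniqueDiffOn.prod uniqueDiffOn_univ)
  have hc := hf'.continuousOn_fderivWithin hu (by norm_num)
  have key : ∀ p ∈ S, divX n (fun ξ => f p.1 ξ p.2.2) p.2.1 =
      ∑ i : Fin n, (EuclideanSpace.proj (𝕜 := ℝ) i : EuclideanSpace ℝ (Fin n) →L[ℝ] ℝ)
        (fderivWithin ℝ F S p (0, EuclideanSpace.single i 1, 0)) := by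
    rintro ⟨t, x, w⟩ hp
    unfold divX
    refine Finset.sum_congr rfl fun i _ => ?_
    have hd : HasFDerivWithinAt F (fderivWithin ℝ F S (t, x, w)) S (t, x, w) :=
      (hf'.differentiableOn (by norm_num) _ hp).hasFDerivWithinAt
    have hi : HasFDerivWithinAt (fun ξ : EuclideanSpace ℝ (Fin n) => (t, ξ, w))
        ((0 : EuclideanSpace ℝ (Fin n) →L[ℝ] ℝ).prod
          ((ContinuousLinearMap.id ℝ (EuclideanSpace ℝ (Fin n))).prod
            (0 : EuclideanSpace ℝ (Fin n) →L[ℝ] ℝ))) Ω x :=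
      (hasFDerivWithinAt_const t x Ω).prodMk
        ((hasFDerivWithinAt_id x Ω).prodMk (hasFDerivWithinAt_const w x Ω))
    have hcomp := HasFDerivWithinAt.comp x hd hi (show MapsTo (fun ξ : EuclideanSpace ℝ (Fin n) => (t, ξ, w)) Ω S from
      fun ξ hξ => ⟨hp.1, hξ, hp.2.2⟩)
    have hcomp2 := hcomp.hasFDerivAt (hΩo.mem_nhds hp.2.1)
    have h3 := ((EuclideanSpace.proj (𝕜 := ℝ) i :
      EuclideanSpace ℝ (Fin n) →L[ℝ] ℝ).hasFDerivAt (x := f t x w)).comp x hcomp2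
    have h4 : HasFDerivAt (fun y => f t y w i) _ x := h3
    rw [h4.fderiv]
    rfl
  refine ContinuousOn.congr ?_ key
  refine continuousOn_finsetSum _ fun i _ => ?_
  exact (ContinuousLinearMap.continuous _).comp_continuousOn (hc.clm_apply continuousOn_const)

noncomputable def rhoY (n : ℕ) (Y : ℝ → ℝ) (p : ℝ × EuclideanSpace ℝ (Fin n)) : ℝ :=
  Y p.1 * ∏ i : Fin n, Y (p.2 i)

theorem rhoY_props (n : ℕ) (Y : ℝ → ℝ) (hYc : Continuous Y) (hY_nn : ∀ s, 0 ≤ Y s)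
    (hY_even : ∀ s, Y (-s) = Y s) (hY_supp : ∀ s : ℝ, 1 ≤ |s| → Y s = 0)
    (hY_int : ∫ s : ℝ, Y s = 1) :
    Continuous (rhoY n Y) ∧ Integrable (rhoY n Y) (volume.prod volume) ∧ (∀ x, 0 ≤ rhoY n Y x) ∧
    (∀ x, rhoY n Y (-x) = rhoY n Y x) ∧ (∃ M, ∀ x, |rhoY n Y x| ≤ M) ∧
    ∫ x, rhoY n Y x ∂(volume.prod volume) = 1 := by
  have hcs : HasCompactSupport Y := by
    refine HasCompactSupport.intro (isCompact_Icc (a := (-1 : ℝ)) (b := 1)) fun x hx => hY_supp x ?_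
    by_contra hlt
    exact hx (abs_le.1 (not_le.1 hlt).le)
  have hYi : Integrable Y := hYc.integrable_of_hasCompactSupport hcs
  obtain ⟨D, hD⟩ := hcs.exists_bound_of_continuous hYc
  have hEi : Integrable (fun x : EuclideanSpace ℝ (Fin n) => ∏ i, Y (x i)) := by
    rw [← (PiLp.volume_preserving_toLp (Fin n)).integrable_comp_emb
      (MeasurableEquiv.toLp 2 (Fin n → ℝ)).measurableEmbedding]
    exact Integrable.fintype_prod (f := fun _ => Y) (fun _ => hYi)
  have hE1 : ∫ x : EuclideanSpace ℝ (Fin n), ∏ i, Y (x i) = 1 := by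
    rw [← (PiLp.volume_preserving_toLp (Fin n)).integral_comp
      (MeasurableEquiv.toLp 2 (Fin n → ℝ)).measurableEmbedding]
    have := integral_fintype_prod_volume_eq_prod (𝕜 := ℝ) (ι := Fin n) (fun _ => Y)
    simp only [hY_int, Finset.prod_const_one] at this
    exact this
  refine ⟨?_, ?_, ?_, ?_, ⟨D * ∏ i : Fin n, D, ?_⟩, ?_⟩
  · unfold rhoY; fun_prop
  · exact hYi.mul_prod hEi
  · intro x; exact mul_nonneg (hY_nn _) (Finset.prod_nonneg fun i _ => hY_nn _)
  · intro x; simp [rhoY, hY_even]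
  · intro x
    unfold rhoY
    rw [abs_mul, Finset.abs_prod]
    have h0 : 0 ≤ D := (norm_nonneg _).trans (hD 0)
    refine mul_le_mul (hD _) (Finset.prod_le_prod (fun i _ => abs_nonneg _) fun i _ => hD _)
      (Finset.prod_nonneg fun i _ => abs_nonneg _) h0
  · have := integral_prod_mul (μ := (volume : Measure ℝ))
      (ν := (volume : Measure (EuclideanSpace ℝ (Fin n)))) Y (fun x => ∏ i, Y (x i))
    rw [hY_int, hE1, mul_one] at this
    exact this

theorem rhoH_eq (n : ℕ) (Y : ℝ → ℝ) (h : ℝ) (t s : ℝ) (x y : EuclideanSpace ℝ (Fin n)) :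
    rhoH (rhoY n Y) h ((t, x) - (s, y)) =
      (Y ((t - s) / h) / h) * ∏ i : Fin n, (Y ((x i - y i) / h) / h) := by
  unfold rhoH rhoY
  rw [Finset.prod_div_distrib, Module.finrank_prod]
  simp [div_eq_inv_mul, pow_add]
  ring

/-- Equation (e2) in the proof of Theorem 4.2: the divergence term in the
doubling-of-variables argument. Here `u = v + z`. -/
theorem doubling_divergence_term
    (n : ℕ) (T : ℝ) (hT : 0 < T)
    (Ω : Set (EuclideanSpace ℝ (Fin n))) (hΩo : IsOpen Ω)
    (hΩb : Bornology.IsBounded Ω)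
    (f : ℝ → EuclideanSpace ℝ (Fin n) → ℝ → EuclideanSpace ℝ (Fin n))
    (hf : ContDiffOn ℝ 2
        (fun p : ℝ × EuclideanSpace ℝ (Fin n) × ℝ => f p.1 p.2.1 p.2.2)
        (Set.Icc 0 T ×ˢ closure Ω ×ˢ Set.univ))
    (v : ℝ → EuclideanSpace ℝ (Fin n) → ℝ)
    (hv_meas : Measurable (fun p : ℝ × EuclideanSpace ℝ (Fin n) => v p.1 p.2))
    (hv_bd : ∃ M : ℝ, ∀ t ∈ Set.Icc 0 T, ∀ x ∈ Ω, |v t x| ≤ M)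
    (z : ℝ → EuclideanSpace ℝ (Fin n) → ℝ)
    (hz_cont : ContinuousOn (fun p : ℝ × EuclideanSpace ℝ (Fin n) => z p.1 p.2)
        (Set.Icc 0 T ×ˢ closure Ω))
    (u : ℝ → EuclideanSpace ℝ (Fin n) → ℝ)
    (hu : ∀ t x, u t x = v t x + z t x)
    (k : ℝ)
    (Y : ℝ → ℝ) (hY_smooth : ContDiff ℝ (⊤ : ℕ∞) Y) (hY_nn : ∀ s, 0 ≤ Y s)
    (hY_even : ∀ s, Y (-s) = Y s) (hY_supp : ∀ s : ℝ, 1 ≤ |s| → Y s = 0)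
    (hY_int : ∫ s : ℝ, Y s = 1)
    (hstar : ℝ) (hhstar : 0 < hstar)
    (φ : ℝ → EuclideanSpace ℝ (Fin n) → ℝ)
    (hφ_smooth : ContDiff ℝ 2 (fun p : ℝ × EuclideanSpace ℝ (Fin n) => φ p.1 p.2))
    (hφ_supp : HasCompactSupport (fun p : ℝ × EuclideanSpace ℝ (Fin n) => φ p.1 p.2))
    (hφ_nn : ∀ t x, 0 ≤ φ t x)
    (hφ_T : ∀ (t : ℝ) (x : EuclideanSpace ℝ (Fin n)), T ≤ t → φ t x = 0)
    (hφ_adm : ∀ (t : ℝ) (x : EuclideanSpace ℝ (Fin n)),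
        (ball x hstar ∩ Ωᶜ).Nonempty → φ t x = 0) :
    Tendsto
      (fun h : ℝ =>
        ∫ t in Set.Icc 0 T, ∫ x in Ω, ∫ s in Set.Icc 0 T, ∫ y in Ω,
          Real.sign (v t x + z s y - k) *
            divX n (fun ξ => f t ξ (z t x - z s y + k)) x *
            psiD n Y φ h t x s y)
      (nhdsWithin 0 (Set.Ioo 0 hstar))
      (nhds (∫ t in Set.Icc 0 T, ∫ x in Ω,
        Real.sign (u t x - k) * divX n (fun ξ => f t ξ k) x * φ t x)) := by
  classical
  have hYc : Continuous Y := hY_smooth.continuous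
  obtain ⟨r1, r2, r3, r4, ⟨M, r5⟩, r6⟩ := rhoY_props n Y hYc hY_nn hY_even hY_supp hY_int
  set B : Set (ℝ × EuclideanSpace ℝ (Fin n)) := Set.Ioo 0 T ×ˢ Ω with hBdef
  have hBo : IsOpen B := isOpen_Ioo.prod hΩo
  have hBb : Bornology.IsBounded B := (Metric.isBounded_Ioo 0 T).prod hΩb
  have hfin : (volume.prod volume : Measure (ℝ × EuclideanSpace ℝ (Fin n))) B ≠ ⊤ :=
    hBb.measure_lt_top.ne
  -- extensions
  obtain ⟨z', hz'c, hz'⟩ := tietze_aux (isClosed_Icc.prod isClosed_closure) _ hz_cont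
  set K : Set (EuclideanSpace ℝ (Fin n)) := {x | ∀ y ∈ Ωᶜ, hstar ≤ dist y x} with hK
  have hKc : IsClosed K := by
    have : K = ⋂ y ∈ Ωᶜ, {x | hstar ≤ dist y x} := by ext x; simp [hK]
    rw [this]
    exact isClosed_biInter fun y _ => isClosed_le continuous_const (by fun_prop)
  have hKΩ : K ⊆ Ω := by
    intro x hx
    by_contra hxo
    have := hx x hxo
    rw [dist_self] at this
    linarith
  have hφK : ∀ t x, x ∉ K → φ t x = 0 := by
    intro t x hx
    simp only [hK, Set.mem_setOf_eq, not_forall, not_le] at hx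
    obtain ⟨y, hy, hd⟩ := hx
    exact hφ_adm t x ⟨y, hd, hy⟩
  have hdiv := (divX_aux n T hT Ω hΩo f hf).mono
    (Set.prod_mono_right (Set.prod_mono_left hKΩ) :
      Set.Icc 0 T ×ˢ K ×ˢ (Set.univ : Set ℝ) ⊆ Set.Icc 0 T ×ˢ Ω ×ˢ Set.univ)
  obtain ⟨G, hGc, hG⟩ := tietze_aux (isClosed_Icc.prod (hKc.prod isClosed_univ)) _ hdiv
  set H : ℝ × EuclideanSpace ℝ (Fin n) → ℝ × EuclideanSpace ℝ (Fin n) → ℝ := fun p q =>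
    G (p.1, p.2, z' p - z' q + k) * φ ((p.1 + q.1) / 2) p.2 with hHdef
  have hφc : Continuous (fun p : ℝ × EuclideanSpace ℝ (Fin n) => φ p.1 p.2) := hφ_smooth.continuous
  have hHc : Continuous (fun x : (ℝ × EuclideanSpace ℝ (Fin n)) × (ℝ × EuclideanSpace ℝ (Fin n)) =>
      H x.1 x.2) := by
    refine Continuous.mul ?_ ?_
    · exact hGc.comp (by fun_prop)
    · exact hφc.comp (by fun_prop :
        Continuous (fun x : (ℝ × EuclideanSpace ℝ (Fin n)) × (ℝ × EuclideanSpace ℝ (Fin n)) =>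
          ((x.1.1 + x.2.1) / 2, x.1.2)))
  obtain ⟨C, hC⟩ := (hBb.isCompact_closure.prod hBb.isCompact_closure).exists_bound_of_continuousOn
    hHc.continuousOn
  have hC' : ∀ p ∈ B, ∀ q ∈ B, |H p q| ≤ C := fun p hp q hq =>
    hC (p, q) ⟨subset_closure hp, subset_closure hq⟩
  have hHeq : ∀ t ∈ Set.Ioo 0 T, ∀ x ∈ Ω, ∀ s ∈ Set.Ioo 0 T, ∀ y ∈ Ω,
      H (t, x) (s, y) = divX n (fun ξ => f t ξ (z t x - z s y + k)) x * φ ((t + s) / 2) x := by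
    intro t ht x hx s hs y hy
    by_cases hxK : x ∈ K
    · have e1 := hG (t, x, z' (t, x) - z' (s, y) + k) ⟨Ioo_subset_Icc_self ht, hxK, trivial⟩
      have e2 := hz' (t, x) ⟨Ioo_subset_Icc_self ht, subset_closure hx⟩
      have e3 := hz' (s, y) ⟨Ioo_subset_Icc_self hs, subset_closure hy⟩
      simp only [hHdef]
      rw [e1, e2, e3]
    · simp only [hHdef]
      rw [hφK _ x hxK, mul_zero, mul_zero]
  set v' : ℝ × EuclideanSpace ℝ (Fin n) → ℝ := fun p => v p.1 p.2 with hv'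
  have main := abs_main (volume.prod volume) (rhoY n Y) r1 r2 r3 r4 M r5 r6 B hBo hfin z' hz'c v'
    hv_meas k H hHc C hC'
  have sgb : ∀ a b : ℝ, |b| ≤ C → |Real.sign a * b| ≤ C := by
    intro a b hb
    rw [abs_mul]
    exact (mul_le_of_le_one_left (abs_nonneg _) (sign_abs_le _)).trans hb
  have hKm : Measurable (fun x : (ℝ × EuclideanSpace ℝ (Fin n)) × (ℝ × EuclideanSpace ℝ (Fin n)) =>
      Real.sign (v' x.1 + z' x.2 - k) * H x.1 x.2) :=
    (sign_meas.comp (((hv_meas.comp measurable_fst).add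
      (hz'c.measurable.comp measurable_snd)).sub_const k)).mul hHc.measurable
  have hfinm : IsFiniteMeasure ((volume.prod volume :
      Measure (ℝ × EuclideanSpace ℝ (Fin n))).restrict B) :=
    ⟨by simpa [lt_top_iff_ne_top] using hfin⟩
  have hR : ∫ p in B, Real.sign (v' p + z' p - k) * H p p ∂(volume.prod volume) =
      ∫ t in Set.Icc 0 T, ∫ x in Ω,
        Real.sign (u t x - k) * divX n (fun ξ => f t ξ k) x * φ t x := by
    rw [integral_Icc_eq_integral_Ioo, setIntegral_prod]
    · refine setIntegral_congr_fun measurableSet_Ioo fun t ht => ?_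
      refine setIntegral_congr_fun hΩo.measurableSet fun x hx => ?_
      have e2 := hz' (t, x) ⟨Ioo_subset_Icc_self ht, subset_closure hx⟩
      rw [hHeq t ht x hx t ht x hx, hu, e2, sub_self, zero_add, add_self_div_two, mul_assoc]
    · have hm := hKm.comp (by fun_prop :
        Measurable (fun p : ℝ × EuclideanSpace ℝ (Fin n) => (p, p)))
      refine Integrable.of_bound hm.aestronglyMeasurable C ?_
      filter_upwards [ae_restrict_mem hBo.measurableSet] with p hp
      exact sgb _ _ (hC' p hp p hp)
  rw [← hR]
  refine (main.mono_left (nhdsWithin_mono _ (fun h hh => hh.1))).congr fun h => ?_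
  have hI := int_aux (volume.prod volume) (rhoY n Y) r1 M r5 B hBo.measurableSet hfin
    (fun p q => Real.sign (v' p + z' q - k) * H p q) hKm C
    (fun p hp q hq => sgb _ _ (hC' p hp q hq)) h
  rw [integral_Icc_eq_integral_Ioo, setIntegral_prod _ hI.integral_prod_left]
  refine setIntegral_congr_fun measurableSet_Ioo fun t ht => ?_
  refine setIntegral_congr_fun hΩo.measurableSet fun x hx => ?_
  have hI2 := int_aux2 (volume.prod volume) (rhoY n Y) r1 M r5 B hBo.measurableSet hfin
    (fun q => Real.sign (v' (t, x) + z' q - k) * H (t, x) q) (hKm.comp measurable_prodMk_left) C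
    (fun q hq => sgb _ _ (hC' (t, x) ⟨ht, hx⟩ q hq)) h (t, x)
  have hI3 := setIntegral_prod _ hI2
  refine hI3.trans ?_
  rw [integral_Icc_eq_integral_Ioo]
  refine setIntegral_congr_fun measurableSet_Ioo fun s hs => ?_
  refine setIntegral_congr_fun hΩo.measurableSet fun y hy => ?_
  have e3 := hz' (s, y) ⟨Ioo_subset_Icc_self hs, subset_closure hy⟩
  rw [hHeq t ht x hx s hs y hy, e3, rhoH_eq]
  simp only [hv', psiD]
  ring
end

section
/- Let T > 0, I = [0,T], and Ω ⊆ ℝⁿ a bounded open set. Let u_o : Ω → ℝ be measurable and bounded, let z : I × closure(Ω) → ℝ be continuous with z(0,ξ) = 0 for all ξ ∈ closure(Ω), let v : I × Ω → ℝ be measurable and bounded with lim_{s→0+} ∫_Ω |v(s,x) − u_o(x)| dx = 0, and let k ∈ ℝ. Fix h* > 0 and an admissible test function φ, and for h ∈ (0,h*) let ψ_h be the associated doubled test function. Then lim_{h→0+} [ ∫_I ∫_Ω ∫_Ω |u_o(x) + z(s,y) − k| · ψ_h(0,x,s,y) dy dx ds + ∫_I ∫_Ω ∫_Ω |v(t,x)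 − k| · ψ_h(t,x,0,y) dy dx dt ] = ∫_Ω |u_o(x) − k| · φ(0,x) dx. (Equation (e4) in the proof of Theorem 4.2: the initial-datum terms in the doubling-of-variables argument.) -/
open MeasureTheory Metric Set Filter

lemma half_int (Y : ℝ → ℝ) (hY_even : ∀ s, Y (-s) = Y s) (hY_int : ∫ s : ℝ, Y s = 1) :
    ∫ s in Ioi (0:ℝ), Y s = 1 / 2 := by
  have h := integral_comp_abs (f := Y)
  have h2 : (fun x : ℝ => Y |x|) = Y := by
    funext x
    rcases abs_choice x with h | h <;> rw [h]
    exact hY_even x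
  rw [h2, hY_int] at h
  linarith

lemma half_int_h (Y : ℝ → ℝ) (hY_even : ∀ s, Y (-s) = Y s) (hY_int : ∫ s : ℝ, Y s = 1)
    (hY_supp : ∀ s : ℝ, 1 ≤ |s| → Y s = 0) (h T : ℝ) (hh : 0 < h) (hT : h ≤ T) :
    ∫ s in Ioc (0:ℝ) T, Y (s / h) / h = 1 / 2 := by
  have h1 : ∫ s in Ioc (0:ℝ) T, Y (s / h) / h = ∫ s in Ioi (0:ℝ), Y (s / h) / h := by
    symm
    apply setIntegral_eq_of_subset_of_forall_sdiff_eq_zero measurableSet_Ioi Ioc_subset_Ioi_self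
    rintro s ⟨hs, hs'⟩
    have hs0 : 0 < s := hs
    have : T < s := by
      by_contra hc
      exact hs' ⟨hs0, not_lt.mp hc⟩
    rw [hY_supp, zero_div]
    rw [abs_of_pos (div_pos hs0 hh), one_le_div hh]
    linarith
  rw [h1, integral_div]
  have := integral_comp_mul_left_Ioi Y 0 (inv_pos.mpr hh)
  simp only [mul_zero, inv_inv, smul_eq_mul, half_int Y hY_even hY_int] at this
  simp only [div_eq_inv_mul] at this ⊢
  rw [this]
  field_simp

lemma time_est (Y : ℝ → ℝ) (hYc : Continuous Y) (hY_nn : ∀ s, 0 ≤ Y s)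
    (hY_even : ∀ s, Y (-s) = Y s) (hY_int : ∫ s : ℝ, Y s = 1)
    (hY_supp : ∀ s : ℝ, 1 ≤ |s| → Y s = 0) (h T : ℝ) (hh : 0 < h) (hT : h ≤ T)
    (F : ℝ → ℝ) (hF : Measurable F) (J ε : ℝ)
    (hFe : ∀ s, 0 < s → s < h → |F s - J| ≤ ε) :
    |(∫ s in Icc 0 T, Y (s / h) / h * F s) - J / 2| ≤ ε / 2 := by
  have hY := half_int_h Y hY_even hY_int hY_supp h T hh hT
  have hYi : IntegrableOn (fun s => Y (s / h) / h) (Ioc 0 T) := by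
    apply Continuous.integrableOn_Ioc
    fun_prop
  have hb : ∀ s ∈ Ioc 0 T, ‖Y (s / h) / h * (F s - J)‖ ≤ Y (s / h) / h * ε := by
    intro s hs
    have h0 : 0 ≤ Y (s / h) / h := div_nonneg (hY_nn _) hh.le
    rw [norm_mul, Real.norm_of_nonneg h0, Real.norm_eq_abs]
    by_cases hsh : s < h
    · exact mul_le_mul_of_nonneg_left (hFe s hs.1 hsh) h0
    · rw [hY_supp]
      · simp
      · rw [abs_of_pos (div_pos hs.1 hh), one_le_div hh]
        linarith
  have hbae : ∀ᵐ s ∂(volume.restrict (Ioc 0 T)), ‖Y (s / h) / h * (F s - J)‖ ≤ Y (s / h) / h * ε :=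
    (ae_restrict_iff' measurableSet_Ioc).2 (Eventually.of_forall hb)
  have hd : IntegrableOn (fun s => Y (s / h) / h * (F s - J)) (Ioc 0 T) := by
    refine Integrable.mono' (hYi.mul_const ε) ?_ hbae
    have : Measurable Y := hYc.measurable
    exact Measurable.aestronglyMeasurable (by fun_prop)
  have e : ∫ s in Icc 0 T, Y (s / h) / h * F s
      = (∫ s in Ioc 0 T, Y (s / h) / h * (F s - J)) + J / 2 := by
    rw [integral_Icc_eq_integral_Ioc]
    have : J / 2 = ∫ s in Ioc 0 T, Y (s / h) / h * J := by
      rw [integral_mul_const, hY]; ring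
    rw [this, ← integral_add hd (hYi.mul_const J)]
    congr 1
    funext s
    ring
  rw [e, add_sub_cancel_right]
  have := norm_integral_le_of_norm_le (hYi.mul_const ε) hbae
  rw [integral_mul_const, hY, Real.norm_eq_abs] at this
  linarith

lemma prod_int (n : ℕ) (Y : ℝ → ℝ) (hY_int : ∫ s : ℝ, Y s = 1) (h : ℝ) (hh : 0 < h)
    (x : EuclideanSpace ℝ (Fin n)) :
    ∫ y : EuclideanSpace ℝ (Fin n), ∏ i : Fin n, (Y ((x i - y i) / h) / h) = 1 := by
  have h1 := (EuclideanSpace.volume_preserving_symm_measurableEquiv_toLp (Fin n)).integral_comp'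
    (fun y : Fin n → ℝ => ∏ i : Fin n, (Y ((x i - y i) / h) / h))
  have h2 : ∫ y : EuclideanSpace ℝ (Fin n), ∏ i : Fin n, (Y ((x i - y i) / h) / h)
     = ∫ y : Fin n → ℝ, ∏ i : Fin n, (Y ((x i - y i) / h) / h) := h1
  rw [h2]
  have h3 := integral_fintype_prod_volume_eq_prod (ι := Fin n) (𝕜 := ℝ) (E := fun _ => ℝ)
    (fun i (y : ℝ) => Y ((x i - y) / h) / h)
  rw [h3]
  apply Finset.prod_eq_one
  intro i _
  rw [integral_div, integral_sub_left_eq_self (fun y => Y (y / h)) volume (x i),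
    Measure.integral_comp_div, hY_int, abs_of_pos hh]
  simp [hh.ne']

lemma prod_int_Ω (n : ℕ) (Y : ℝ → ℝ) (hY_int : ∫ s : ℝ, Y s = 1)
    (hY_supp : ∀ s : ℝ, 1 ≤ |s| → Y s = 0) (h : ℝ) (hh : 0 < h)
    (Ω : Set (EuclideanSpace ℝ (Fin n)))
    (x : EuclideanSpace ℝ (Fin n)) (hstar : ℝ) (hb : ball x hstar ⊆ Ω)
    (hhs : (n + 1) * h < hstar) :
    ∫ y in Ω, ∏ i : Fin n, (Y ((x i - y i) / h) / h) = 1 := by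
  rw [setIntegral_eq_integral_of_forall_compl_eq_zero, prod_int n Y hY_int h hh x]
  intro y hy
  by_contra hne
  apply hy
  apply hb
  rw [mem_ball, dist_comm, EuclideanSpace.dist_eq]
  replace hne := Finset.prod_ne_zero_iff.mp hne
  refine lt_of_le_of_lt ?_ hhs
  have hn : (0:ℝ) ≤ n := Nat.cast_nonneg n
  rw [Real.sqrt_le_left (by positivity)]
  have : ∑ i : Fin n, dist (x i) (y i) ^ 2 ≤ ∑ i : Fin n, h ^ 2 := by
    apply Finset.sum_le_sum
    intro i hi
    have h1 := hne i hi
    have h2 : |x i - y i| < h := by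
      by_contra hc
      apply h1
      rw [hY_supp, zero_div]
      rw [abs_div, abs_of_pos hh, one_le_div hh]
      linarith
    rw [Real.dist_eq]
    exact pow_le_pow_left₀ (abs_nonneg _) h2.le 2
  refine this.trans ?_
  simp
  nlinarith [sq_nonneg h, mul_nonneg hn (sq_nonneg h), mul_nonneg (mul_nonneg hn hn) (sq_nonneg h)]

lemma space_est (n : ℕ)
    (Ω : Set (EuclideanSpace ℝ (Fin n))) (hΩo : IsOpen Ω)
    (hΩb : Bornology.IsBounded Ω)
    (u_o : EuclideanSpace ℝ (Fin n) → ℝ)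
    (huo_meas : Measurable u_o) (M : ℝ) (hM : 0 ≤ M)
    (huo_bd : ∀ x ∈ Ω, |u_o x| ≤ M)
    (ζ : EuclideanSpace ℝ (Fin n) → ℝ) (hζm : Measurable ζ)
    (w : EuclideanSpace ℝ (Fin n) → ℝ) (hw : Measurable w)
    (hwb : ∀ x ∈ Ω, |w x| ≤ M)
    (k : ℝ)
    (Y : ℝ → ℝ) (hYc : Continuous Y) (hY_nn : ∀ s, 0 ≤ Y s)
    (hY_supp : ∀ s : ℝ, 1 ≤ |s| → Y s = 0)
    (hY_int : ∫ s : ℝ, Y s = 1)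
    (hstar : ℝ) (h : ℝ) (hh : 0 < h) (hhs : (n + 1) * h < hstar)
    (f f0 : EuclideanSpace ℝ (Fin n) → ℝ) (hf : Continuous f) (hf0 : Continuous f0)
    (hfnn : ∀ x, 0 ≤ f x) (C : ℝ) (hC : ∀ x, f x ≤ C) (hC0 : ∀ x, |f0 x| ≤ C)
    (hadm : ∀ x, (ball x hstar ∩ Ωᶜ).Nonempty → f x = 0)
    (ε : ℝ) (hζ : ∀ y ∈ Ω, |ζ y| ≤ ε) (hff : ∀ x ∈ Ω, |f x - f0 x| ≤ ε) :
    |(∫ x in Ω, ∫ y in Ω, |w x + ζ y - k| * (f x * ∏ i : Fin n, (Y ((x i - y i) / h) / h)))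
      - ∫ x in Ω, |u_o x - k| * f0 x| ≤
      (C + M + |k|) * ε * volume.real Ω + C * ∫ x in Ω, |w x - u_o x| := by
  have hYm : Measurable Y := hYc.measurable
  have hΩm : MeasurableSet Ω := hΩo.measurableSet
  have hfin : volume Ω < ⊤ := hΩb.measure_lt_top
  have : IsFiniteMeasure (volume.restrict Ω) := ⟨by simpa using hfin⟩
  have hpt : ∀ x ∈ Ω, ‖(∫ y in Ω, |w x + ζ y - k| * (f x * ∏ i : Fin n, (Y ((x i - y i) / h) / h)))
      - |u_o x - k| * f0 x‖ ≤ (C + M + |k|) * ε + C * |w x - u_o x| := by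
    intro x hx
    have hε : 0 ≤ ε := (abs_nonneg _).trans (hζ x hx)
    have hk : |u_o x - k| ≤ M + |k| := (abs_sub _ _).trans (by linarith [huo_bd x hx])
    have h2 : |(|u_o x - k| * f x - |u_o x - k| * f0 x)| ≤ (M + |k|) * ε := by
      rw [← mul_sub, abs_mul, abs_abs]
      exact mul_le_mul hk (hff x hx) (abs_nonneg _) (by positivity)
    have h1 : |(∫ y in Ω, |w x + ζ y - k| * (f x * ∏ i : Fin n, (Y ((x i - y i) / h) / h)))
        - |u_o x - k| * f x| ≤ C * (ε + |w x - u_o x|) := by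
      by_cases hfx : f x = 0
      · have : 0 ≤ C := (hfnn x).trans (hC x)
        simp only [hfx, zero_mul, mul_zero, integral_zero, sub_zero, abs_zero]
        positivity
      have hball : ball x hstar ⊆ Ω := by
        intro y hy
        by_contra hc
        exact hfx (hadm x ⟨y, hy, hc⟩)
      have hP := prod_int_Ω n Y hY_int hY_supp h hh Ω x hstar hball hhs
      set P : EuclideanSpace ℝ (Fin n) → ℝ := fun y => ∏ i : Fin n, (Y ((x i - y i) / h) / h) with hPdef
      change ∫ y in Ω, P y = 1 at hP
      have hPi : IntegrableOn P Ω := by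
        by_contra hc
        rw [integral_undef hc] at hP
        exact zero_ne_one hP
      have hPnn : ∀ y, 0 ≤ P y := fun y =>
        Finset.prod_nonneg fun i _ => div_nonneg (hY_nn _) hh.le
      have hPm : Measurable P := by rw [hPdef]; fun_prop
      have hb : ∀ᵐ y ∂(volume.restrict Ω), ‖(|w x + ζ y - k| - |u_o x - k|) * (f x * P y)‖
          ≤ (C * (ε + |w x - u_o x|)) * P y := by
        refine (ae_restrict_iff' hΩm).2 (Eventually.of_forall fun y hy => ?_)
        rw [norm_mul, Real.norm_eq_abs, Real.norm_of_nonneg (mul_nonneg (hfnn x) (hPnn y))]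
        have a1 : |(|w x + ζ y - k| - |u_o x - k|)| ≤ ε + |w x - u_o x| := by
          refine (abs_abs_sub_abs_le_abs_sub _ _).trans ?_
          have : w x + ζ y - k - (u_o x - k) = ζ y + (w x - u_o x) := by ring
          rw [this]
          exact (abs_add_le _ _).trans (by linarith [hζ y hy])
        have a2 : f x * P y ≤ C * P y := mul_le_mul_of_nonneg_right (hC x) (hPnn y)
        calc _ ≤ (ε + |w x - u_o x|) * (C * P y) :=
              mul_le_mul a1 a2 (mul_nonneg (hfnn x) (hPnn y)) (by positivity)
          _ = _ := by ring
      have hd : IntegrableOn (fun y => (|w x + ζ y - k| - |u_o x - k|) * (f x * P y)) Ω := by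
        refine Integrable.mono' (hPi.const_mul _) ?_ hb
        exact Measurable.aestronglyMeasurable (by fun_prop)
      have e : ∫ y in Ω, |w x + ζ y - k| * (f x * P y) =
          (∫ y in Ω, (|w x + ζ y - k| - |u_o x - k|) * (f x * P y)) + |u_o x - k| * f x := by
        have : |u_o x - k| * f x = ∫ y in Ω, (|u_o x - k| * f x) * P y := by
          rw [integral_const_mul, hP, mul_one]
        rw [this, ← integral_add hd (hPi.const_mul _)]
        congr 1
        funext y
        ring
      change |(∫ y in Ω, |w x + ζ y - k| * (f x * P y)) - |u_o x - k| * f x| ≤ _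
      rw [e, add_sub_cancel_right]
      have := norm_integral_le_of_norm_le (hPi.const_mul _) hb
      rwa [integral_const_mul, hP, mul_one] at this
    rw [Real.norm_eq_abs]
    have := abs_sub_le (∫ y in Ω, |w x + ζ y - k| * (f x * ∏ i : Fin n, (Y ((x i - y i) / h) / h)))
      (|u_o x - k| * f x) (|u_o x - k| * f0 x)
    linarith
  have hpta := (ae_restrict_iff' (μ := volume) hΩm).2 (Eventually.of_forall hpt)
  have hwu : IntegrableOn (fun x => |w x - u_o x|) Ω := by
    refine Integrable.of_bound (C := M + M) (Measurable.aestronglyMeasurable (by fun_prop)) ?_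
    refine (ae_restrict_iff' hΩm).2 (Eventually.of_forall fun x hx => ?_)
    rw [Real.norm_eq_abs, abs_abs]
    exact (abs_sub _ _).trans (add_le_add (hwb x hx) (huo_bd x hx))
  have hBi : IntegrableOn (fun x => (C + M + |k|) * ε + C * |w x - u_o x|) Ω :=
    (integrable_const _).add (hwu.const_mul _)
  have hGm : Measurable (fun x => ∫ y in Ω, |w x + ζ y - k| *
      (f x * ∏ i : Fin n, (Y ((x i - y i) / h) / h))) := by
    apply StronglyMeasurable.measurable
    apply StronglyMeasurable.integral_prod_right
      (f := fun x y => |w x + ζ y - k| * (f x * ∏ i : Fin n, (Y ((x i - y i) / h) / h)))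
    apply Measurable.stronglyMeasurable
    have := hf.measurable
    fun_prop
  have hf0m := hf0.measurable
  have hbase : IntegrableOn (fun x => |u_o x - k| * f0 x) Ω := by
    refine Integrable.of_bound (C := (M + |k|) * C) (Measurable.aestronglyMeasurable (by fun_prop)) ?_
    refine (ae_restrict_iff' hΩm).2 (Eventually.of_forall fun x hx => ?_)
    rw [norm_mul, Real.norm_eq_abs, Real.norm_eq_abs, abs_abs]
    refine mul_le_mul ?_ (hC0 x) (abs_nonneg _) (by positivity)
    exact (abs_sub _ _).trans (by linarith [huo_bd x hx])
  have hd := Integrable.mono' hBi (hGm.sub (by fun_prop)).aestronglyMeasurable hpta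
  have hG : IntegrableOn (fun x => ∫ y in Ω, |w x + ζ y - k| *
      (f x * ∏ i : Fin n, (Y ((x i - y i) / h) / h))) Ω := by
    have := hd.add hbase
    refine this.congr (Eventually.of_forall fun x => ?_)
    simp
  rw [← integral_sub hG hbase]
  have := norm_integral_le_of_norm_le hBi hpta
  rw [integral_add (integrable_const _) (hwu.const_mul _),
    integral_const_mul C (fun x => |w x - u_o x|)] at this
  simp only [integral_const, smul_eq_mul, measureReal_restrict_apply_univ] at this
  rw [Real.norm_eq_abs] at this
  linarith

lemma half_limit
    (n : ℕ) (T : ℝ) (hT : 0 < T)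
    (Ω : Set (EuclideanSpace ℝ (Fin n))) (hΩo : IsOpen Ω)
    (hΩb : Bornology.IsBounded Ω)
    (u_o : EuclideanSpace ℝ (Fin n) → ℝ)
    (huo_meas : Measurable u_o) (M : ℝ) (hM : 0 ≤ M)
    (huo_bd : ∀ x ∈ Ω, |u_o x| ≤ M)
    (z : ℝ → EuclideanSpace ℝ (Fin n) → ℝ)
    (hz_meas : Measurable (fun p : ℝ × EuclideanSpace ℝ (Fin n) => z p.1 p.2))
    (hz0 : ∀ ε > 0, ∃ δ > 0, ∀ s, 0 < s → s < δ → ∀ y ∈ Ω, |z s y| ≤ ε)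
    (v : ℝ → EuclideanSpace ℝ (Fin n) → ℝ)
    (hv_meas : Measurable (fun p : ℝ × EuclideanSpace ℝ (Fin n) => v p.1 p.2))
    (hv_bd : ∀ t ∈ Set.Icc 0 T, ∀ x ∈ Ω, |v t x| ≤ M)
    (hv0 : Tendsto (fun s : ℝ => ∫ x in Ω, |v s x - u_o x|)
        (nhdsWithin 0 (Set.Ioi 0)) (nhds 0))
    (k : ℝ)
    (Y : ℝ → ℝ) (hYc : Continuous Y) (hY_nn : ∀ s, 0 ≤ Y s)
    (hY_even : ∀ s, Y (-s) = Y s) (hY_supp : ∀ s : ℝ, 1 ≤ |s| → Y s = 0)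
    (hY_int : ∫ s : ℝ, Y s = 1)
    (hstar : ℝ) (hhstar : 0 < hstar)
    (φ : ℝ → EuclideanSpace ℝ (Fin n) → ℝ)
    (hφc : Continuous (fun p : ℝ × EuclideanSpace ℝ (Fin n) => φ p.1 p.2))
    (hφ_supp : HasCompactSupport (fun p : ℝ × EuclideanSpace ℝ (Fin n) => φ p.1 p.2))
    (hφ_nn : ∀ t x, 0 ≤ φ t x)
    (hφ_adm : ∀ (t : ℝ) (x : EuclideanSpace ℝ (Fin n)),
        (ball x hstar ∩ Ωᶜ).Nonempty → φ t x = 0) :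
    Tendsto
      (fun h : ℝ => ∫ s in Set.Icc 0 T, Y (s / h) / h * ∫ x in Ω, ∫ y in Ω,
            |v s x + z s y - k| * (φ (s / 2) x * ∏ i : Fin n, (Y ((x i - y i) / h) / h)))
      (nhdsWithin 0 (Set.Ioo 0 hstar))
      (nhds ((∫ x in Ω, |u_o x - k| * φ 0 x) / 2)) := by
  obtain ⟨C, hC⟩ := hφ_supp.exists_bound_of_continuous hφc
  have hC' : ∀ t x, |φ t x| ≤ C := fun t x => hC (t, x)
  have hC0 : 0 ≤ C := (abs_nonneg _).trans (hC' 0 0)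
  have huc := hφ_supp.uniformContinuous_of_continuous hφc
  rw [Metric.uniformContinuous_iff] at huc
  rw [Metric.tendsto_nhds]
  intro ε hε
  set K := (C + M + |k|) * volume.real Ω + C + 1 with hK
  have hKpos : 0 < K := by positivity
  set η := ε / K with hη
  have hηpos : 0 < η := div_pos hε hKpos
  obtain ⟨δ₁, hδ₁, H₁⟩ := hz0 η hηpos
  obtain ⟨δ₂, hδ₂, H₂⟩ := huc η hηpos
  rw [Metric.tendsto_nhdsWithin_nhds] at hv0
  obtain ⟨δ₃, hδ₃, H₃⟩ := hv0 η hηpos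
  have hev : ∀ δ > (0:ℝ), ∀ᶠ h in nhdsWithin (0:ℝ) (Set.Ioo 0 hstar), h < δ := fun δ hδ =>
    mem_nhdsWithin_of_mem_nhds (Iio_mem_nhds hδ)
  have hn : (0:ℝ) < n + 1 := by positivity
  filter_upwards [hev δ₁ hδ₁, hev δ₂ hδ₂, hev δ₃ hδ₃, hev T hT,
    hev (hstar / (n + 1)) (div_pos hhstar hn), self_mem_nhdsWithin] with h h1 h2 h3 h4 h5 h6
  have hh : 0 < h := h6.1
  have hhs : (n + 1) * h < hstar := by
    rw [lt_div_iff₀ hn] at h5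
    linarith
  rw [Real.dist_eq]
  refine lt_of_le_of_lt (time_est Y hYc hY_nn hY_even hY_int hY_supp h T hh h4.le _ ?_ _ ε ?_)
    (by linarith)
  · apply StronglyMeasurable.measurable
    apply StronglyMeasurable.integral_prod_right (f := fun s x => ∫ y in Ω,
            |v s x + z s y - k| * (φ (s / 2) x * ∏ i : Fin n, (Y ((x i - y i) / h) / h)))
    apply StronglyMeasurable.integral_prod_right
      (f := fun (p : ℝ × EuclideanSpace ℝ (Fin n)) (y : EuclideanSpace ℝ (Fin n)) =>
            |v p.1 p.2 + z p.1 y - k| * (φ (p.1 / 2) p.2 *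
              ∏ i : Fin n, (Y ((p.2 i - y i) / h) / h)))
    apply Measurable.stronglyMeasurable
    have hYm := hYc.measurable
    have a1 : Measurable (fun q : (ℝ × EuclideanSpace ℝ (Fin n)) × EuclideanSpace ℝ (Fin n) =>
        v q.1.1 q.1.2) := hv_meas.comp measurable_fst
    have a2 : Measurable (fun q : (ℝ × EuclideanSpace ℝ (Fin n)) × EuclideanSpace ℝ (Fin n) =>
        z q.1.1 q.2) := hz_meas.comp (measurable_fst.fst.prodMk measurable_snd)
    have a3 : Measurable (fun q : (ℝ × EuclideanSpace ℝ (Fin n)) × EuclideanSpace ℝ (Fin n) =>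
        φ (q.1.1 / 2) q.1.2) :=
      hφc.measurable.comp ((measurable_fst.fst.div_const 2).prodMk measurable_fst.snd)
    have a4 : Measurable (fun q : (ℝ × EuclideanSpace ℝ (Fin n)) × EuclideanSpace ℝ (Fin n) =>
        ∏ i : Fin n, (Y ((q.1.2 i - q.2 i) / h) / h)) := by fun_prop
    exact (continuous_abs.measurable.comp ((a1.add a2).sub_const k)).mul (a3.mul a4)
  · intro s hs hsh
    have key := space_est n Ω hΩo hΩb u_o huo_meas M hM huo_bd (z s)
      (hz_meas.comp measurable_prodMk_left) (v s) (hv_meas.comp measurable_prodMk_left)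
      (hv_bd s ⟨hs.le, by linarith⟩) k Y hYc hY_nn hY_supp hY_int hstar h hh hhs
      (φ (s / 2)) (φ 0) (hφc.comp (Continuous.prodMk_right (s / 2)))
      (hφc.comp (Continuous.prodMk_right 0)) (hφ_nn _) C
      (fun x => (le_abs_self _).trans (hC' _ x)) (hC' 0) (hφ_adm _) η
      (H₁ s hs (by linarith)) (fun x _ => by
        have := @H₂ (s / 2, x) (0, x) (by
          rw [Prod.dist_eq, dist_self, Real.dist_eq, sub_zero, abs_of_pos (by linarith),
            max_lt_iff]
          constructor <;> linarith)
        rw [Real.dist_eq] at this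
        exact this.le)
    refine key.trans ?_
    have h3' := @H₃ s hs (by rw [Real.dist_eq, sub_zero, abs_of_pos hs]; linarith)
    rw [Real.dist_eq, sub_zero] at h3'
    have h3'' := (le_abs_self _).trans h3'.le
    have e : η * K = ε := div_mul_cancel₀ _ hKpos.ne'
    have := mul_le_mul_of_nonneg_left h3'' hC0
    rw [hK] at e
    nlinarith

/-- Equation (e4) in the proof of Theorem 4.2: the initial-datum terms in the
doubling-of-variables argument. -/
theorem doubling_initial_datum_term
    (n : ℕ) (T : ℝ) (hT : 0 < T)
    (Ω : Set (EuclideanSpace ℝ (Fin n))) (hΩo : IsOpen Ω)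
    (hΩb : Bornology.IsBounded Ω)
    (u_o : EuclideanSpace ℝ (Fin n) → ℝ)
    (huo_meas : Measurable u_o)
    (huo_bd : ∃ M : ℝ, ∀ x ∈ Ω, |u_o x| ≤ M)
    (z : ℝ → EuclideanSpace ℝ (Fin n) → ℝ)
    (hz_cont : ContinuousOn (fun p : ℝ × EuclideanSpace ℝ (Fin n) => z p.1 p.2)
        (Set.Icc 0 T ×ˢ closure Ω))
    (hz0 : ∀ ξ ∈ closure Ω, z 0 ξ = 0)
    (v : ℝ → EuclideanSpace ℝ (Fin n) → ℝ)
    (hv_meas : Measurable (fun p : ℝ × EuclideanSpace ℝ (Fin n) => v p.1 p.2))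
    (hv_bd : ∃ M : ℝ, ∀ t ∈ Set.Icc 0 T, ∀ x ∈ Ω, |v t x| ≤ M)
    (hv0 : Tendsto (fun s : ℝ => ∫ x in Ω, |v s x - u_o x|)
        (nhdsWithin 0 (Set.Ioi 0)) (nhds 0))
    (k : ℝ)
    (Y : ℝ → ℝ) (hY_smooth : ContDiff ℝ (⊤ : ℕ∞) Y) (hY_nn : ∀ s, 0 ≤ Y s)
    (hY_even : ∀ s, Y (-s) = Y s) (hY_supp : ∀ s : ℝ, 1 ≤ |s| → Y s = 0)
    (hY_int : ∫ s : ℝ, Y s = 1)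
    (hstar : ℝ) (hhstar : 0 < hstar)
    (φ : ℝ → EuclideanSpace ℝ (Fin n) → ℝ)
    (hφ_smooth : ContDiff ℝ 2 (fun p : ℝ × EuclideanSpace ℝ (Fin n) => φ p.1 p.2))
    (hφ_supp : HasCompactSupport (fun p : ℝ × EuclideanSpace ℝ (Fin n) => φ p.1 p.2))
    (hφ_nn : ∀ t x, 0 ≤ φ t x)
    (hφ_T : ∀ (t : ℝ) (x : EuclideanSpace ℝ (Fin n)), T ≤ t → φ t x = 0)
    (hφ_adm : ∀ (t : ℝ) (x : EuclideanSpace ℝ (Fin n)),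
        (ball x hstar ∩ Ωᶜ).Nonempty → φ t x = 0) :
    Tendsto
      (fun h : ℝ =>
        (∫ s in Set.Icc 0 T, ∫ x in Ω, ∫ y in Ω,
            |u_o x + z s y - k| * psiD n Y φ h 0 x s y) +
        (∫ t in Set.Icc 0 T, ∫ x in Ω, ∫ y in Ω,
            |v t x - k| * psiD n Y φ h t x 0 y))
      (nhdsWithin 0 (Set.Ioo 0 hstar))
      (nhds (∫ x in Ω, |u_o x - k| * φ 0 x)) := by
  obtain ⟨M₁, hM₁⟩ := huo_bd
  obtain ⟨M₂, hM₂⟩ := hv_bd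
  set M := max (max M₁ M₂) 0 with hMdef
  have hM : 0 ≤ M := le_max_right _ _
  have hu : ∀ x ∈ Ω, |u_o x| ≤ M := fun x hx =>
    (hM₁ x hx).trans ((le_max_left _ _).trans (le_max_left _ _))
  have hv : ∀ t ∈ Set.Icc 0 T, ∀ x ∈ Ω, |v t x| ≤ M := fun t ht x hx =>
    (hM₂ t ht x hx).trans ((le_max_right _ _).trans (le_max_left _ _))
  have hYc := hY_smooth.continuous
  have hφc := hφ_smooth.continuous
  classical
  set S : Set (ℝ × EuclideanSpace ℝ (Fin n)) := Set.Icc 0 T ×ˢ closure Ω with hS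
  have hSm : MeasurableSet S := measurableSet_Icc.prod isClosed_closure.measurableSet
  have hSc : IsCompact S := isCompact_Icc.prod hΩb.isCompact_closure
  let z' : ℝ → EuclideanSpace ℝ (Fin n) → ℝ := fun s y => if (s, y) ∈ S then z s y else 0
  have hz'm : Measurable (fun p : ℝ × EuclideanSpace ℝ (Fin n) => z' p.1 p.2) := by
    have := ContinuousOn.measurable_piecewise (g := fun _ => (0:ℝ)) hz_cont
      continuousOn_const hSm
    exact this
  have hz's : ∀ ε > 0, ∃ δ > 0, ∀ s, 0 < s → s < δ → ∀ y ∈ Ω, |z' s y| ≤ ε := by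
    intro ε hε
    have huc := hSc.uniformContinuousOn_of_continuous hz_cont
    rw [Metric.uniformContinuousOn_iff] at huc
    obtain ⟨δ, hδ, H⟩ := huc ε hε
    refine ⟨δ, hδ, fun s hs hsδ y hy => ?_⟩
    by_cases hmem : (s, y) ∈ S
    · have h0 : ((0:ℝ), y) ∈ S := ⟨⟨le_rfl, hT.le⟩, subset_closure hy⟩
      have := H (s, y) hmem (0, y) h0 (by
        rw [Prod.dist_eq, dist_self, Real.dist_eq, sub_zero, abs_of_pos hs, max_lt_iff]
        exact ⟨hsδ, hδ⟩)
      simp only [hz0 y (subset_closure hy), Real.dist_eq, sub_zero] at this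
      simp only [z', if_pos hmem]
      exact this.le
    · simp only [z', if_neg hmem, abs_zero]
      exact hε.le
  have L1 := half_limit n T hT Ω hΩo hΩb u_o huo_meas M hM hu z' hz'm hz's
    (fun _ => u_o) (huo_meas.comp measurable_snd) (fun _ _ => hu) (by simp) k Y hYc hY_nn hY_even
    hY_supp hY_int hstar hhstar φ hφc hφ_supp hφ_nn hφ_adm
  have L2 := half_limit n T hT Ω hΩo hΩb u_o huo_meas M hM hu (fun _ _ => 0) measurable_const
    (fun ε hε => ⟨1, one_pos, fun _ _ _ _ _ => by simpa using hε.le⟩)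
    v hv_meas hv hv0 k Y hYc hY_nn hY_even
    hY_supp hY_int hstar hhstar φ hφc hφ_supp hφ_nn hφ_adm
  have L := L1.add L2
  rw [add_halves] at L
  refine L.congr fun h => ?_
  congr 1
  · refine setIntegral_congr_fun measurableSet_Icc fun s hs => ?_
    simp only
    rw [← integral_const_mul]
    refine setIntegral_congr_fun hΩo.measurableSet fun x hx => ?_
    rw [← integral_const_mul]
    refine setIntegral_congr_fun hΩo.measurableSet fun y hy => ?_
    have hmem : (s, y) ∈ S := ⟨hs, subset_closure hy⟩
    simp only [z', if_pos hmem, psiD, zero_add, zero_sub, neg_div, hY_even]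
    ring
  · refine setIntegral_congr_fun measurableSet_Icc fun s hs => ?_
    simp only
    rw [← integral_const_mul]
    refine setIntegral_congr_fun hΩo.measurableSet fun x hx => ?_
    rw [← integral_const_mul]
    refine setIntegral_congr_fun hΩo.measurableSet fun y hy => ?_
    simp only [psiD, add_zero, sub_zero]
    ring
end

section
/- Let T > 0, L ≥ 0 and C ≥ 0. Let a : [0,T] → [0,∞) be measurable and essentially bounded and b : [0,T] → [0,∞) be integrable. Assume that for every nonnegative twice continuously differentiable function Ψ with compact support contained in (0,T): ∫₀^T ( a(s)·Ψ'(s) + L·a(s)·Ψ(s) + C·b(s)·Ψ(s) ) ds ≥ 0. Then there exists a Lebesgue-null set N ⊆ (0,T) such that for all τ, t ∈ (0,T) ∖ N with τ < t: a(t) ≤ e^{L(t−τ)}·a(τ) + C·∫_τ^t e^{L(t−s)}·b(s) ds. (The Gronwall-type argument, estimates (3) and (9), in the proof of Theorem 4.3, with a(t) = ∫_Ω |u(t,x)−v(t,x)| dx and b(s) = ∫_{∂Ω} |u_b(s,ξ)−v_b(s,ξ)| dξ.) -/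
open MeasureTheory Set Filter Topology

lemma wg_core (A B : ℝ → ℝ) (hA : Integrable A) (hB : Integrable B) (hBn : ∀ s, 0 ≤ B s) (T : ℝ)
   (h : ∀ Φ : ℝ → ℝ, ContDiff ℝ 2 Φ → HasCompactSupport Φ →
        tsupport Φ ⊆ Set.Ioo 0 T → (∀ s, 0 ≤ Φ s) →
        0 ≤ ∫ s, (A s * deriv Φ s + B s * Φ s)) 
   (φ : ContDiffBump (0:ℝ)) (τ t : ℝ) (hτt : τ < t) (h0 : φ.rOut < τ) (hT : t + φ.rOut < T) :
   (convolution (φ.normed volume) A (ContinuousLinearMap.lsmul ℝ ℝ) volume) t ≤ 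
   (convolution (φ.normed volume) A (ContinuousLinearMap.lsmul ℝ ℝ) volume) τ 
     + ∫ s in (τ - φ.rOut)..(t + φ.rOut), B s := by
  set ρ := φ.normed volume with hρ
  have hρc : ContDiff ℝ 1 ρ := φ.contDiff_normed
  have hρcont : Continuous ρ := hρc.continuous
  have hρn : ∀ x, 0 ≤ ρ x := fun x => φ.nonneg_normed x
  have hρi : Integrable ρ := φ.integrable_normed
  have hρ1 : ∫ x, ρ x = 1 := φ.integral_normed
  have hsym : ∀ x, ρ (-x) = ρ x := fun x => φ.normed_neg x
  have hsupp : ∀ x, φ.rOut ≤ |x| → ρ x = 0 := by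
    intro x hx
    have : x ∉ Function.support ρ := by
      rw [hρ, φ.support_normed_eq]
      simpa using hx
    simpa using this
  have hconv : ∀ x, (convolution ρ A (ContinuousLinearMap.lsmul ℝ ℝ) volume) x
      = ∫ s, A s * ρ (s - x) := by
    intro x
    rw [convolution_eq_swap]
    congr 1
    ext s
    rw [← hsym (s - x)]
    simp [mul_comm]
  have hρb : ∃ K, ∀ x, ‖ρ x‖ ≤ K := by
    exact hρcont.bounded_above_of_compact_support φ.hasCompactSupport_normed
  obtain ⟨K, hK⟩ := hρb
  have hAi : ∀ x, Integrable (fun s => A s * ρ (s - x)) := by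
    intro x
    refine hA.mul_bdd (c := K) (hρcont.comp (by fun_prop)).aestronglyMeasurable ?_
    exact Eventually.of_forall fun s => hK _
  set F : ℝ → ℝ := fun x => ∫ r in (0:ℝ)..x, ρ r with hF
  have hFd : ∀ x, HasDerivAt F (ρ x) x := fun x => 
    intervalIntegral.integral_hasDerivAt_right (hρcont.intervalIntegrable _ _)
      (hρcont.stronglyMeasurableAtFilter _ _) hρcont.continuousAt
  have hFc : ContDiff ℝ 2 F := by
    have : deriv F = ρ := funext fun x => (hFd x).deriv
    rw [show (2 : WithTop ℕ∞) = 1 + 1 by norm_num, contDiff_succ_iff_deriv]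
    refine ⟨fun x => (hFd x).differentiableAt, by simp, by rwa [this]⟩
  set Φ : ℝ → ℝ := fun s => F (s - τ) - F (s - t) with hΦ
  have hΦd : ∀ s, deriv Φ s = ρ (s - τ) - ρ (s - t) := by
    intro s
    exact (((hFd (s-τ)).comp_sub_const s τ).sub ((hFd (s-t)).comp_sub_const s t)).deriv
  have hΦi : ∀ s, Φ s = ∫ r in (s-t)..(s-τ), ρ r := by
    intro s
    simp only [hΦ, hF]
    exact intervalIntegral.integral_interval_sub_left (hρcont.intervalIntegrable _ _) (hρcont.intervalIntegrable _ _) 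
  have hΦn : ∀ s, 0 ≤ Φ s := by
    intro s
    rw [hΦi]
    exact intervalIntegral.integral_nonneg (by linarith) fun x _ => hρn x
  have hΦ1 : ∀ s, Φ s ≤ 1 := by
    intro s
    rw [hΦi, ← hρ1, intervalIntegral.integral_of_le (by linarith)]
    exact setIntegral_le_integral hρi (Eventually.of_forall hρn)
  have hΦc : ContDiff ℝ 2 Φ := by
    exact (hFc.comp (by fun_prop)).sub (hFc.comp (by fun_prop))
  have hΦz : ∀ s, s ∉ Icc (τ - φ.rOut) (t + φ.rOut) → Φ s = 0 := by
    intro s hs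
    rw [hΦi]
    apply intervalIntegral.integral_zero_ae
    refine Eventually.of_forall fun x hx => hsupp x ?_
    rw [uIoc_of_le (by linarith)] at hx
    rw [mem_Icc, not_and_or, not_le, not_le] at hs
    rw [le_abs]
    rcases hs with hs | hs
    · right; linarith [hx.2]
    · left; linarith [hx.1]
  have hts : tsupport Φ ⊆ Icc (τ - φ.rOut) (t + φ.rOut) := by
    apply closure_minimal _ isClosed_Icc
    intro s hs
    by_contra hc
    exact hs (hΦz s hc)
  have hcs : HasCompactSupport Φ := isCompact_Icc.of_isClosed_subset (isClosed_tsupport _) hts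
  have hrp := φ.rOut_pos
  have key := h Φ hΦc hcs (hts.trans fun s hs => ⟨by linarith [hs.1], by linarith [hs.2]⟩) hΦn
  have hBΦ : Integrable (fun s => B s * Φ s) := by
    refine hB.mul_bdd (c := 1) hΦc.continuous.aestronglyMeasurable ?_
    refine Eventually.of_forall fun s => ?_
    rw [Real.norm_eq_abs, abs_of_nonneg (hΦn s)]
    exact hΦ1 s
  have e1 : ∫ s, (A s * deriv Φ s + B s * Φ s) = 
     (∫ s, A s * ρ (s - τ)) - (∫ s, A s * ρ (s - t)) + ∫ s, B s * Φ s := by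
    have hsub : Integrable (fun s => A s * ρ (s - τ) - A s * ρ (s - t)) := (hAi τ).sub (hAi t)
    rw [← integral_sub (hAi _) (hAi _), ← integral_add hsub hBΦ]
    congr 1
    ext s
    simp [hΦd]; ring
  have e2 : ∫ s, B s * Φ s ≤ ∫ s in (τ - φ.rOut)..(t + φ.rOut), B s := by
    rw [intervalIntegral.integral_of_le (by linarith), ← integral_Icc_eq_integral_Ioc, 
      ← integral_indicator measurableSet_Icc]
    apply integral_mono hBΦ (hB.indicator measurableSet_Icc)
    intro s
    by_cases hs : s ∈ Icc (τ - φ.rOut) (t + φ.rOut)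
    · simp only [indicator_of_mem hs]
      nlinarith [hBn s, hΦ1 s]
    · simp [indicator_of_notMem hs, hΦz s hs]
  rw [hconv, hconv]
  linarith

lemma wg_ae (A B : ℝ → ℝ) (hA : Integrable A) (hB : Integrable B) (hBn : ∀ s, 0 ≤ B s) (T : ℝ)
   (h : ∀ Φ : ℝ → ℝ, ContDiff ℝ 2 Φ → HasCompactSupport Φ →
        tsupport Φ ⊆ Set.Ioo 0 T → (∀ s, 0 ≤ Φ s) →
        0 ≤ ∫ s, (A s * deriv Φ s + B s * Φ s)) :
   ∃ N : Set ℝ, volume N = 0 ∧ ∀ τ ∈ Ioo 0 T \ N, ∀ t ∈ Ioo 0 T \ N, τ < t → 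
     A t ≤ A τ + ∫ s in τ..t, B s := by
  let φ : ℕ → ContDiffBump (0:ℝ) := fun n => 
    ⟨1 / ((n:ℝ) + 1), 2 * (1 / ((n:ℝ) + 1)), by positivity, by 
      have : 0 < 1 / ((n:ℝ) + 1) := by positivity
      linarith⟩
  have hr : Tendsto (fun n => (φ n).rOut) atTop (𝓝 0) := by
    have h2 := (tendsto_one_div_add_atTop_nhds_zero_nat (𝕜 := ℝ)).const_mul 2
    rw [mul_zero] at h2
    exact h2
  have hae := ContDiffBump.ae_convolution_tendsto_right_of_locallyIntegrable (μ := volume) (φ := φ)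
    (l := atTop) (K := 2) (g := A) hr (Eventually.of_forall fun n => le_rfl) hA.locallyIntegrable
  refine ⟨_, ae_iff.1 hae, ?_⟩
  rintro τ ⟨hτ, hτN⟩ t ⟨ht, htN⟩ hlt
  simp only [mem_ofPred_eq, not_not] at hτN htN
  have hprim : Continuous fun x => ∫ s in (0:ℝ)..x, B s := 
    intervalIntegral.continuous_primitive (fun _ _ => hB.intervalIntegrable) 0
  have hl : Tendsto (fun n => ∫ s in (τ - (φ n).rOut)..(t + (φ n).rOut), B s) atTop 
      (𝓝 (∫ s in τ..t, B s)) := by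
    have hs : ∀ x y, ∫ s in x..y, B s = (∫ s in (0:ℝ)..y, B s) - ∫ s in (0:ℝ)..x, B s := 
      fun x y => (intervalIntegral.integral_interval_sub_left hB.intervalIntegrable hB.intervalIntegrable).symm
    simp_rw [hs (_ - _), hs τ t]
    refine Tendsto.sub ?_ ?_
    · refine (hprim.tendsto t).comp ?_
      simpa using hr.const_add t
    · refine (hprim.tendsto τ).comp ?_
      simpa using hr.const_sub τ
  refine le_of_tendsto_of_tendsto htN (hτN.add hl) ?_
  filter_upwards [hr.eventually (gt_mem_nhds hτ.1), hr.eventually (gt_mem_nhds (sub_pos.2 ht.2))] with n h1 h2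
  exact wg_core A B hA hB hBn T h (φ n) τ t hlt h1 (by linarith)

theorem weak_gronwall_estimate
    (T : ℝ) (hT : 0 < T) (L C : ℝ) (hL : 0 ≤ L) (hC : 0 ≤ C)
    (a b : ℝ → ℝ)
    (ha_meas : Measurable a)
    (ha_nn : ∀ t ∈ Set.Icc 0 T, 0 ≤ a t)
    (ha_bd : ∃ M : ℝ, ∀ᵐ t ∂(volume.restrict (Set.Icc (0:ℝ) T)), |a t| ≤ M)
    (hb_int : IntegrableOn b (Set.Icc 0 T))
    (hb_nn : ∀ t ∈ Set.Icc 0 T, 0 ≤ b t)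
    (hineq : ∀ Ψ : ℝ → ℝ, ContDiff ℝ 2 Ψ → HasCompactSupport Ψ →
        tsupport Ψ ⊆ Set.Ioo 0 T → (∀ s, 0 ≤ Ψ s) →
        0 ≤ ∫ s in Set.Icc 0 T,
              (a s * deriv Ψ s + L * a s * Ψ s + C * b s * Ψ s)) :
    ∃ N : Set ℝ, N ⊆ Set.Ioo 0 T ∧ volume N = 0 ∧
      ∀ τ ∈ Set.Ioo 0 T \ N, ∀ t ∈ Set.Ioo 0 T \ N, τ < t →
        a t ≤ Real.exp (L * (t - τ)) * a τ +
          C * ∫ s in Set.Icc τ t, Real.exp (L * (t - s)) * b s := by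
  set E : ℝ → ℝ := fun s => Real.exp (-(L * s)) with hE
  have hEc : Continuous E := by fun_prop
  obtain ⟨M, hM⟩ := ha_bd
  have ha_int : IntegrableOn a (Icc 0 T) := by
    refine Measure.integrableOn_of_bounded (M := M) (by simp) ha_meas.aestronglyMeasurable ?_
    exact hM
  set A : ℝ → ℝ := (Icc 0 T).indicator (fun s => E s * a s) with hA
  set B : ℝ → ℝ := (Icc 0 T).indicator (fun s => C * (E s * b s)) with hB
  have hAi : Integrable A := 
    (integrable_indicator_iff measurableSet_Icc).2 (ha_int.continuousOn_mul hEc.continuousOn isCompact_Icc)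
  have hBi : Integrable B := 
    (integrable_indicator_iff measurableSet_Icc).2 
      ((hb_int.continuousOn_mul hEc.continuousOn isCompact_Icc).const_mul C)
  have hBn : ∀ s, 0 ≤ B s := by
    intro s
    apply indicator_nonneg
    intro x hx
    have := hb_nn x hx
    positivity
  obtain ⟨N, hN0, hN⟩ := wg_ae A B hAi hBi hBn T (by
    intro Φ hc hcs hts hn
    have hΨc : ContDiff ℝ 2 (fun s => E s * Φ s) := by
      refine ContDiff.mul ?_ hc
      simp only [hE]; fun_prop
    have hsub : tsupport (fun s => E s * Φ s) ⊆ tsupport Φ := tsupport_mul_subset_right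
    have := hineq (fun s => E s * Φ s) hΨc hcs.mul_left (hsub.trans hts)
      (fun s => mul_nonneg (Real.exp_pos _).le (hn s))
    rw [← integral_indicator measurableSet_Icc] at this
    refine this.trans_eq (integral_congr_ae (Eventually.of_forall fun s => ?_))
    by_cases hs : s ∈ Icc 0 T
    · simp only [hA, hB, indicator_of_mem hs]
      have hd : HasDerivAt E (E s * (-(L * 1))) s := 
        (((hasDerivAt_id s).const_mul L).neg).exp
      have hd2 := (hd.mul ((hc.differentiable (by norm_num)) s).hasDerivAt).deriv
      have hd3 : deriv (fun s => E s * Φ s) s = _ := hd2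
      rw [hd3]
      ring
    · simp only [hA, hB, indicator_of_notMem hs]; simp)
  refine ⟨N ∩ Ioo 0 T, inter_subset_right, measure_mono_null inter_subset_left hN0, ?_⟩
  rintro τ ⟨hτ, hτN⟩ t ⟨ht, htN⟩ hlt
  have key := hN τ ⟨hτ, fun h => hτN ⟨h, hτ⟩⟩ t ⟨ht, fun h => htN ⟨h, ht⟩⟩ hlt
  have e3 : ∫ s in τ..t, B s = ∫ s in Icc τ t, C * (E s * b s) := by
    rw [intervalIntegral.integral_of_le hlt.le, ← integral_Icc_eq_integral_Ioc]
    refine setIntegral_congr_fun measurableSet_Icc fun s hs => ?_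
    have hs' : s ∈ Icc 0 T := ⟨hτ.1.le.trans hs.1, hs.2.trans ht.2.le⟩
    simp only [hB, indicator_of_mem hs']
  rw [e3] at key
  simp only [hA, indicator_of_mem (Ioo_subset_Icc_self hτ), indicator_of_mem (Ioo_subset_Icc_self ht)] at key
  have key2 := mul_le_mul_of_nonneg_left key (Real.exp_pos (L * t)).le
  rw [mul_add, ← integral_const_mul, ← mul_assoc, ← mul_assoc] at key2
  have hEE : ∀ s, Real.exp (L * t) * E s = Real.exp (L * (t - s)) := by
    intro s
    rw [hE, ← Real.exp_add]; ring_nf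
  rw [hEE, hEE] at key2
  simp only [sub_self, mul_zero, Real.exp_zero, one_mul] at key2
  refine key2.trans_eq ?_
  rw [← integral_const_mul]
  congr 2
  ext s
  rw [← hEE]; ring
end
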